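/- arXiv:1604.08466 — 10 statements merged into one kernel-verified Lean document; each statement's English description precedes it below -/
import Mathlib

section
/- For every natural number n and every real x, the orthonormal probabilists' Hermite polynomial satisfies |H_n(x)| ≤ 1.09 · e^{x²/4}. -/
open MeasureTheory ProbabilityTheory

/-- The standard Gaussian probability measure `γ₁` on `ℝ`. -/
noncomputable def stdGaussian : Measure ℝ := gaussianReal 0 1

/-- The orthonormal probabilists' Hermite polynomial `H_n(x) = He_n(x)/√(n!)`. -/
noncomputable def Hnorm (n : ℕ) (x : ℝ) : ℝ :=
  (Polynomial.aeval x (Polynomial.hermite n)) / Real.sqrt (Nat.factorial n)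

/-- A family of univariate quadrature rules: at level `l`, `m l` nodes and weights. -/
structure QuadFamily where
  m : ℕ → ℕ
  node : ℕ → ℕ → ℝ
  weight : ℕ → ℕ → ℝ

variable {E : Type*} [NormedAddCommGroup E] [NormedSpace ℝ E]

/-- The univariate quadrature `Q_l(f) = Σ_k w_k^l f(y_k^l)`. -/
noncomputable def QuadFamily.quad (Q : QuadFamily) (l : ℕ) (f : ℝ → E) : E :=
  ∑ k ∈ Finset.range (Q.m l), Q.weight l k • f (Q.node l k)

/-- Assumption A.1: `Q_l` integrates exactly every polynomial of degree `≤ l`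
against the standard Gaussian measure. -/
def QuadFamily.ExactA1 (Q : QuadFamily) : Prop :=
  ∀ l : ℕ, ∀ p : Polynomial ℝ, p.natDegree ≤ l →
    Q.quad l (fun x => p.eval x) = ∫ x, p.eval x ∂stdGaussian

/-- Assumption A.2: `|Q_l(H_n)| < 2` for all levels `l` and degrees `n`. -/
def QuadFamily.BoundedA2 (Q : QuadFamily) : Prop :=
  ∀ l n : ℕ, |Q.quad l (Hnorm n)| < 2

/-- Tensor-product quadrature over the finite set `s` of dimensions, at levels `lev j`,
applied to `f : ℝ^ℕ → E`, coordinates outside `s` being evaluated at `0`. -/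
noncomputable def QuadFamily.tensor (Q : QuadFamily) (s : Finset ℕ) (lev : ℕ → ℕ)
    (f : (ℕ → ℝ) → E) : E :=
  ∑ k ∈ s.pi (fun j => Finset.range (Q.m (lev j))),
    (∏ j ∈ s.attach, Q.weight (lev j.1) (k j.1 j.2)) •
      f (fun j => if h : j ∈ s then Q.node (lev j) (k j h) else 0)

/-- The tensorized difference operator
`Δ_ν = ⊗_{j ∈ supp ν} (Q_{ν_j} - Q_{ν_j - 1})`, expanded as the alternating-sign
sum over subsets `T ⊆ supp ν` of the tensor quadrature at levels `ν - 1_T`. -/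
noncomputable def QuadFamily.delta (Q : QuadFamily) (ν : ℕ →₀ ℕ) (f : (ℕ → ℝ) → E) : E :=
  ∑ T ∈ ν.support.powerset, (-1 : ℝ) ^ T.card •
    Q.tensor ν.support (fun j => ν j - (if j ∈ T then 1 else 0)) f

/-- The sparse quadrature `Q_Λ(f) = Σ_{ν ∈ Λ} Δ_ν(f)`. -/
noncomputable def QuadFamily.sparse (Q : QuadFamily) (Λ : Finset (ℕ →₀ ℕ))
    (f : (ℕ → ℝ) → E) : E :=
  ∑ ν ∈ Λ, Q.delta ν f

/-- The multivariate Hermite polynomial `H_ν(y) = ∏_{j ∈ supp ν} H_{ν_j}(y_j)`. -/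
noncomputable def Hmulti (ν : ℕ →₀ ℕ) (y : ℕ → ℝ) : ℝ :=
  ∏ j ∈ ν.support, Hnorm (ν j) (y j)

/-- A set of multi-indices is downward closed (admissible). -/
def DownwardClosed (Λ : Set (ℕ →₀ ℕ)) : Prop :=
  ∀ ν ∈ Λ, ∀ μ : ℕ →₀ ℕ, μ ≤ ν → μ ∈ Λ

/-- `γ` is the countable product of standard Gaussian measures on `ℝ^ℕ`:
a probability measure whose finite-dimensional marginals are products of `γ₁`. -/
def IsProductGaussian (γ : Measure (ℕ → ℝ)) : Prop :=
  IsProbabilityMeasure γ ∧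
  ∀ n : ℕ, γ.map (fun y (i : Fin n) => y (i : ℕ)) =
    Measure.pi (fun _ : Fin n => stdGaussian)

/-- The weight `b_ν = ∏_j Σ_{l=0}^r binom(ν_j, l) τ_j^{2l}` (a finite product over `supp ν`). -/
noncomputable def bwt (r : ℕ) (τ : ℕ → ℝ) (ν : ℕ →₀ ℕ) : ℝ :=
  ∏ j ∈ ν.support, ∑ l ∈ Finset.range (r + 1), ((ν j).choose l : ℝ) * τ j ^ (2 * l)

/-- The weight `c_ν = ∏_{j ∈ supp ν} (1 + ν_j)³`. -/
noncomputable def cwt (ν : ℕ →₀ ℕ) : ℝ :=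
  ∏ j ∈ ν.support, ((1 : ℝ) + ν j) ^ 3


theorem cderiv_gaussian (n : ℕ) (x : ℂ) :
    deriv^[n] (fun y : ℂ => Complex.exp (-(y ^ 2 / 2))) x =
    (-1 : ℂ) ^ n * Polynomial.aeval x (Polynomial.hermite n) * Complex.exp (-(x ^ 2 / 2)) := by
  rw [mul_assoc]
  induction n generalizing x with
  | zero => simp
  | succ n ih =>
    replace ih : deriv^[n] _ = _ := _root_.funext ih
    have deriv_gaussian :
      deriv (fun y : ℂ => Complex.exp (-(y ^ 2 / 2))) x = -x * Complex.exp (-(x ^ 2 / 2)) := by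
      rw [deriv_cexp (by fun_prop)]
      simp [mul_comm]
    rw [Function.iterate_succ_apply', ih, deriv_const_mul_field, deriv_fun_mul, pow_succ (-1 : ℂ),
      deriv_gaussian, Polynomial.hermite_succ, map_sub, map_mul, Polynomial.aeval_X, Polynomial.deriv_aeval]
    · ring
    · apply Polynomial.differentiable_aeval
    · fun_prop

theorem cauchy_hermite (n : ℕ) (x R : ℝ) (hR : 0 < R) :
    |Polynomial.aeval x (Polynomial.hermite n)| ≤
      n.factorial * ((2 * Real.pi)⁻¹ * ∫ θ in (0:ℝ)..2 * Real.pi,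
        Real.exp (x ^ 2 / 4 + R ^ 2 / 2 - (R * Real.cos θ + x / 2) ^ 2)) * R⁻¹ ^ n := by
  set F : ℂ → ℂ := fun y : ℂ => Complex.exp (-(y ^ 2 / 2)) with hF
  have hd : Differentiable ℂ F := by rw [hF]; fun_prop
  have h1 := (hd.hasFPowerSeriesOnBall (x : ℂ) (R := ⟨R, hR.le⟩) hR).factorial_smul 1 n
  have h2 := norm_cauchyPowerSeries_le F (x : ℂ) R n
  rw [← iteratedDeriv_eq_iteratedFDeriv, iteratedDeriv_eq_iterate, cderiv_gaussian] at h1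
  have h3 : ‖Polynomial.aeval (x : ℂ) (Polynomial.hermite n)‖ = |Polynomial.aeval x (Polynomial.hermite n)| := by
    have : Polynomial.aeval (x : ℂ) (Polynomial.hermite n) = ((Polynomial.aeval x (Polynomial.hermite n) : ℝ) : ℂ) := by
      exact (Polynomial.aeval_algebraMap_apply ℂ x (Polynomial.hermite n))
    rw [this, Complex.norm_real, Real.norm_eq_abs]
  have h4 := congrArg norm h1
  rw [norm_mul, norm_mul, h3, Complex.norm_exp] at h4
  have h5 : (-((x : ℂ) ^ 2 / 2)).re = -(x ^ 2 / 2) := by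
    have : (-((x : ℂ) ^ 2 / 2)) = ((-(x ^ 2 / 2) : ℝ) : ℂ) := by push_cast; ring
    rw [this, Complex.ofReal_re]
  rw [h5] at h4
  have h6 : ‖cauchyPowerSeries F (x : ℂ) R n fun _ => (1 : ℂ)‖ ≤ ‖cauchyPowerSeries F (x : ℂ) R n‖ := by
    have := (cauchyPowerSeries F (x : ℂ) R n).le_opNorm (fun _ => 1)
    simp only [norm_one, Finset.prod_const_one, mul_one] at this
    exact this
  have h7 : ∀ θ, ‖F (circleMap x R θ)‖ = Real.exp (-(x ^ 2 / 2)) * Real.exp (x ^ 2 / 4 + R ^ 2 / 2 - (R * Real.cos θ + x / 2) ^ 2) := by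
    intro θ
    rw [hF]; simp only
    rw [Complex.norm_exp, ← Real.exp_add]
    congr 1
    have hc : circleMap x R θ = ⟨x + R * Real.cos θ, R * Real.sin θ⟩ := by
      apply Complex.ext <;> simp [circleMap, Complex.exp_ofReal_mul_I_re, Complex.exp_ofReal_mul_I_im]
    rw [hc, pow_two]
    have := Real.sin_sq_add_cos_sq θ
    simp
    have h8 : Real.sin θ ^ 2 = 1 - Real.cos θ ^ 2 := by linarith
    ring_nf
    rw [h8]; ring
  simp_rw [h7] at h2
  rw [intervalIntegral.integral_const_mul, abs_of_pos hR] at h2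
  have e : 0 < Real.exp (-(x ^ 2 / 2)) := Real.exp_pos _
  have h9 : |Polynomial.aeval x (Polynomial.hermite n)| * Real.exp (-(x ^ 2 / 2)) = n.factorial * ‖cauchyPowerSeries F (x : ℂ) R n fun _ => (1 : ℂ)‖ := by
    have : ‖(-1 : ℂ) ^ n‖ = 1 := by simp
    rw [this, one_mul] at h4
    rw [← h4]
    rw [nsmul_eq_mul, norm_mul, Complex.norm_natCast]
    rfl
  refine le_of_mul_le_mul_right ?_ e
  rw [h9]
  calc _ ≤ (n.factorial : ℝ) * _ := mul_le_mul_of_nonneg_left (h6.trans h2) (by positivity)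
    _ = _ := by ring

theorem rearr (c a : ℝ) (hc : 0 < c) :
    ∫ θ in (0:ℝ)..Real.pi, Real.exp (-c * (Real.cos θ + a) ^ 2) ≤
      ∫ θ in (0:ℝ)..Real.pi, Real.exp (-c * ((1 - Real.cos θ) / 2) ^ 2) := by
  have hp := Real.pi_pos.le
  rw [intervalIntegral.integral_of_le hp, intervalIntegral.integral_of_le hp,
    ← integral_Icc_eq_integral_Ioc, ← integral_Icc_eq_integral_Ioc]
  have cf : Continuous fun θ => Real.exp (-c * (Real.cos θ + a) ^ 2) := by fun_prop
  have cg : Continuous fun θ => Real.exp (-c * ((1 - Real.cos θ) / 2) ^ 2) := by fun_prop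
  rw [integral_eq_lintegral_of_nonneg_ae (ae_of_all _ fun _ => (Real.exp_pos _).le) cf.aestronglyMeasurable,
    integral_eq_lintegral_of_nonneg_ae (ae_of_all _ fun _ => (Real.exp_pos _).le) cg.aestronglyMeasurable]
  apply ENNReal.toReal_mono
  · have := (cg.integrableOn_Icc (a := 0) (b := Real.pi) (μ := volume)).lintegral_lt_top
    exact this.ne
  rw [lintegral_eq_lintegral_meas_le _ (ae_of_all _ fun _ => (Real.exp_pos _).le) cf.aemeasurable,
    lintegral_eq_lintegral_meas_le _ (ae_of_all _ fun _ => (Real.exp_pos _).le) cg.aemeasurable]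
  apply lintegral_mono
  intro t
  simp only
  have mS : IsClosed {θ | t ≤ Real.exp (-c * (Real.cos θ + a) ^ 2)} := isClosed_le continuous_const cf
  have mT : IsClosed {θ | t ≤ Real.exp (-c * ((1 - Real.cos θ) / 2) ^ 2)} := isClosed_le continuous_const cg
  rw [Measure.restrict_apply mS.measurableSet, Measure.restrict_apply mT.measurableSet]
  set S := {θ | t ≤ Real.exp (-c * (Real.cos θ + a) ^ 2)} ∩ Set.Icc 0 Real.pi with hS
  rcases S.eq_empty_or_nonempty with h | h
  · rw [h]; simp
  have hcS : IsCompact S := isCompact_Icc.inter_left mS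
  obtain ⟨B, hB, hmin⟩ := hcS.exists_isLeast h
  have : S ⊆ (fun x => x + (-B)) ⁻¹' ({θ | t ≤ Real.exp (-c * ((1 - Real.cos θ) / 2) ^ 2)} ∩ Set.Icc 0 Real.pi) := by
    intro A hA
    have hBA := hmin hA
    obtain ⟨hA1, hA2, hA3⟩ := hA
    obtain ⟨hB1, hB2, hB3⟩ := hB
    simp only [Set.mem_ofPred_eq, Set.mem_preimage, Set.mem_inter_iff, Set.mem_Icc] at *
    refine ⟨?_, by linarith, by linarith⟩
    have key : 1 - Real.cos (A + -B) ≤ Real.cos B - Real.cos A := by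
      have e1 : Real.cos (A + -B) = 1 - 2 * Real.sin ((A - B)/2) ^ 2 := by
        have := Real.cos_two_mul ((A - B)/2)
        have h2 := Real.sin_sq_add_cos_sq ((A-B)/2)
        rw [show 2 * ((A - B)/2) = A + -B by ring] at this
        linarith
      have e2 : Real.cos B - Real.cos A = 2 * Real.sin ((A+B)/2) * Real.sin ((A-B)/2) := by
        have := Real.cos_sub_cos B A
        rw [this, show (B - A)/2 = -((A-B)/2) by ring, Real.sin_neg, add_comm B A]; ring
      have e3 : 0 ≤ Real.sin ((A-B)/2) := Real.sin_nonneg_of_nonneg_of_le_pi (by linarith) (by linarith)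
      have e4 : Real.sin ((A-B)/2) ≤ Real.sin ((A+B)/2) := by
        rcases le_total ((A+B)/2) (Real.pi/2) with h | h
        · exact Real.sin_le_sin_of_le_of_le_pi_div_two (by linarith) h (by linarith)
        · rw [← Real.sin_pi_sub ((A+B)/2)]
          exact Real.sin_le_sin_of_le_of_le_pi_div_two (by linarith) (by linarith) (by linarith)
      rw [e1, e2]; nlinarith
    have h0 : Real.cos (A + -B) ≤ 1 := Real.cos_le_one _
    set u := Real.cos A + a
    set v := Real.cos B + a
    have huv : 1 - Real.cos (A + -B) ≤ v - u := by simp only [u, v]; linarith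
    rcases le_total (u^2) (v^2) with hq | hq
    · refine hB1.trans (Real.exp_le_exp.2 ?_)
      have : ((1 - Real.cos (A + -B)) / 2)^2 ≤ v^2 := by
        have : |u| ≤ |v| := sq_le_sq.1 hq
        rw [sq_le_sq, abs_of_nonneg (by linarith)]
        rcases abs_cases u with h | h <;> rcases abs_cases v with h' | h' <;> linarith
      nlinarith
    · refine hA1.trans (Real.exp_le_exp.2 ?_)
      have : ((1 - Real.cos (A + -B)) / 2)^2 ≤ u^2 := by
        have : |v| ≤ |u| := sq_le_sq.1 hq
        rw [sq_le_sq, abs_of_nonneg (by linarith)]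
        rcases abs_cases u with h | h <;> rcases abs_cases v with h' | h' <;> linarith
      nlinarith
  calc volume S ≤ _ := measure_mono this
    _ = _ := measure_preimage_add_right _ _ _

theorem Gamma_mid (s : ℝ) (hs : 0 < s) :
    Real.Gamma (s + 1/4) ^ 2 ≤ Real.Gamma s * Real.Gamma (s + 1/2) := by
  have h := Real.Gamma_mul_add_mul_le_rpow_Gamma_mul_rpow_Gamma hs (show 0 < s + 1/2 by linarith)
    (show (0:ℝ) < 1/2 by norm_num) (show (0:ℝ) < 1/2 by norm_num) (by norm_num)
  rw [show 1/2 * s + 1/2 * (s + 1/2) = s + 1/4 by ring] at h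
  have g1 := Real.Gamma_pos_of_pos hs
  have g2 := Real.Gamma_pos_of_pos (show 0 < s + 1/2 by linarith)
  have g3 := Real.Gamma_pos_of_pos (show 0 < s + 1/4 by linarith)
  rw [← Real.sqrt_eq_rpow, ← Real.sqrt_eq_rpow, ← Real.sqrt_mul g1.le] at h
  calc _ ≤ _ := pow_le_pow_left₀ g3.le h 2
    _ = _ := Real.sq_sqrt (by positivity)

theorem sqrt_pi_lt : √Real.pi ≤ 1.77246 := by
  rw [Real.sqrt_le_left (by norm_num)]
  linarith [Real.pi_lt_d6]

theorem Gamma_54 : Real.Gamma (5/4) ≤ 0.917 := by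
  have h := Gamma_mid 3 (by norm_num)
  have a1 : Real.Gamma 3 = 2 := by
    rw [show (3:ℝ) = ((2:ℕ):ℝ) + 1 by norm_num, Real.Gamma_nat_eq_factorial]; norm_num [Nat.factorial]
  have a2 : Real.Gamma (3 + 1/2) = 15/8 * √Real.pi := by
    rw [show (3 + 1/2 : ℝ) = 5/2 + 1 by norm_num, Real.Gamma_add_one (by norm_num),
      show (5/2 : ℝ) = 3/2 + 1 by norm_num, Real.Gamma_add_one (by norm_num),
      show (3/2 : ℝ) = 1/2 + 1 by norm_num, Real.Gamma_add_one (by norm_num), Real.Gamma_one_half_eq]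
    ring
  have a3 : Real.Gamma (3 + 1/4) = 45/16 * Real.Gamma (5/4) := by
    rw [show (3 + 1/4 : ℝ) = 9/4 + 1 by norm_num, Real.Gamma_add_one (by norm_num),
      show (9/4 : ℝ) = 5/4 + 1 by norm_num, Real.Gamma_add_one (by norm_num)]
    ring
  rw [a1, a2, a3] at h
  have := sqrt_pi_lt
  by_contra hc
  push Not at hc
  nlinarith

theorem Gamma_34 : Real.Gamma (3/4) ≤ 1.2554 := by
  have h := Gamma_mid (3/2) (by norm_num)
  have a1 : Real.Gamma (3/2 + 1/2) = 1 := by norm_num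
  have a2 : Real.Gamma (3/2) = 1/2 * √Real.pi := by
    rw [show (3/2 : ℝ) = 1/2 + 1 by norm_num, Real.Gamma_add_one (by norm_num), Real.Gamma_one_half_eq]
  have a3 : Real.Gamma (3/2 + 1/4) = 3/4 * Real.Gamma (3/4) := by
    rw [show (3/2 + 1/4 : ℝ) = 3/4 + 1 by norm_num, Real.Gamma_add_one (by norm_num)]
  rw [a1, a2, a3] at h
  have := sqrt_pi_lt
  by_contra hc
  push Not at hc
  nlinarith

theorem mom (k : ℕ) (c : ℝ) (hc : 0 < c) :
    IntegrableOn (fun s : ℝ => s ^ k * Real.exp (-c * s ^ 4)) (Set.Ioi 0) ∧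
    ∫ s in Set.Ioi (0:ℝ), s ^ k * Real.exp (-c * s ^ 4) =
      c ^ (-((k:ℝ) + 1) / 4) * (1/4) * Real.Gamma (((k:ℝ) + 1) / 4) := by
  have hk : (-1:ℝ) < k := by have : (0:ℝ) ≤ k := Nat.cast_nonneg k
                             linarith
  have h1 := integrableOn_rpow_mul_exp_neg_mul_rpow hk (show (0:ℝ) < 4 by norm_num) hc
  have h2 := integral_rpow_mul_exp_neg_mul_rpow (show (0:ℝ) < 4 by norm_num) hk hc
  have e : (fun x : ℝ => x ^ (k:ℝ) * Real.exp (-c * x ^ (4:ℝ))) = fun s : ℝ => s ^ k * Real.exp (-c * s ^ 4) := by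
    ext x
    rw [Real.rpow_natCast, show (4:ℝ) = ((4:ℕ):ℝ) by norm_num, Real.rpow_natCast]
  rw [e] at h1 h2
  exact ⟨h1, h2⟩

theorem Gint (c : ℝ) (hc : 0 < c) :
    IntegrableOn (fun s : ℝ => (1 + s^2/2 + 10/9*s^4) * Real.exp (-c * s ^ 4)) (Set.Ioi 0) ∧
    ∫ s in Set.Ioi (0:ℝ), (1 + s^2/2 + 10/9*s^4) * Real.exp (-c * s ^ 4) =
      c ^ (-(1/4) : ℝ) * Real.Gamma (5/4) + c ^ (-(3/4) : ℝ) * (1/8) * Real.Gamma (3/4)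
       + c ^ (-(5/4) : ℝ) * (5/18) * Real.Gamma (5/4) := by
  obtain ⟨i0, e0⟩ := mom 0 c hc
  obtain ⟨i2, e2⟩ := mom 2 c hc
  obtain ⟨i4, e4⟩ := mom 4 c hc
  have e : (fun s : ℝ => (1 + s^2/2 + 10/9*s^4) * Real.exp (-c * s ^ 4)) =
    fun s => (s ^ 0 * Real.exp (-c * s ^ 4) + (1/2) * (s ^ 2 * Real.exp (-c * s ^ 4))) + (10/9) * (s ^ 4 * Real.exp (-c * s ^ 4)) := by
    ext s; ring
  have i2' := i2.const_mul (1/2)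
  have i4' := i4.const_mul (10/9)
  rw [e]
  refine ⟨(i0.add i2').add i4', ?_⟩
  have i02 : IntegrableOn (fun s : ℝ => s ^ 0 * Real.exp (-c * s ^ 4) + (1/2) * (s ^ 2 * Real.exp (-c * s ^ 4))) (Set.Ioi 0) := i0.add i2'
  rw [integral_add i02 i4', integral_add i0 i2', integral_const_mul, integral_const_mul, e0, e2, e4]
  have g : Real.Gamma (5/4) = 1/4 * Real.Gamma (1/4) := by
    rw [show (5/4 : ℝ) = 1/4 + 1 by norm_num, Real.Gamma_add_one (by norm_num)]
  push_cast
  norm_num [g]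
  ring

theorem J1 (c : ℝ) (hc : 0 < c) :
    ∫ t in (0:ℝ)..(Real.pi/3), Real.exp (-c * Real.sin t ^ 4) ≤
      ∫ s in Set.Ioi (0:ℝ), (1 + s^2/2 + 10/9*s^4) * Real.exp (-c * s ^ 4) := by
  have hp := Real.pi_pos
  set G : ℝ → ℝ := fun s => (1 + s^2/2 + 10/9*s^4) * Real.exp (-c * s ^ 4) with hG
  have cG : Continuous G := by rw [hG]; fun_prop
  have h1 : ∫ t in (0:ℝ)..(Real.pi/3), Real.exp (-c * Real.sin t ^ 4) ≤
     ∫ t in (0:ℝ)..(Real.pi/3), (G ∘ Real.sin) t * Real.cos t := by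
    apply intervalIntegral.integral_mono_on (by positivity)
    · apply Continuous.intervalIntegrable; fun_prop
    · apply Continuous.intervalIntegrable; fun_prop
    intro t ht
    obtain ⟨ht0, ht1⟩ := ht
    have hcos : 1/2 ≤ Real.cos t := by
      rw [← Real.cos_pi_div_three]
      exact Real.cos_le_cos_of_nonneg_of_le_pi ht0 (by linarith) ht1
    have hsc := Real.sin_sq_add_cos_sq t
    set C := Real.cos t
    set y := Real.sin t ^ 2 with hy
    have hy0 : 0 ≤ y := sq_nonneg _
    have hy1 : y ≤ 3/4 := by nlinarith
    have key : 1 ≤ (1 + y/2 + 10/9*y^2) * C := by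
      have : 1 ≤ ((1 + y/2 + 10/9*y^2) * C)^2 := by
        have e : C^2 = 1 - y := by linarith
        rw [mul_pow, e]
        have : 0 ≤ y^2 * (3/4 - y) * (100/81*y^2 + 65/81*y+53/27) := by
          have : 0 ≤ 3/4 - y := by linarith
          positivity
        nlinarith
      nlinarith [show 0 ≤ (1 + y/2 + 10/9*y^2) * C by positivity]
    simp only [hG, Function.comp]
    have e4 : Real.sin t ^ 4 = y^2 := by rw [hy]; ring
    rw [e4]
    have := Real.exp_pos (-c * y^2)
    nlinarith
  have h2 := intervalIntegral.integral_comp_mul_deriv (a := 0) (b := Real.pi/3) (f := Real.sin) (f' := Real.cos) (g := G)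
    (fun x _ => Real.hasDerivAt_sin x) Real.continuous_cos.continuousOn cG
  rw [h2, Real.sin_zero, Real.sin_pi_div_three, intervalIntegral.integral_of_le (show 0 ≤ √3/2 by positivity)] at h1
  refine h1.trans ?_
  apply setIntegral_mono_set (Gint c hc).1
  · exact ae_of_all _ fun s => by simp only [hG, Pi.zero_apply]; positivity
  · exact Set.Ioc_subset_Ioi_self.eventuallyLE

theorem J2 (c : ℝ) (hc : 0 < c) :
    ∫ t in (Real.pi/3)..(Real.pi/2), Real.exp (-c * Real.sin t ^ 4) ≤ Real.pi/6 * Real.exp (-c * (9/16)) := by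
  have hp := Real.pi_pos
  have h1 : ∫ t in (Real.pi/3)..(Real.pi/2), Real.exp (-c * Real.sin t ^ 4) ≤
     ∫ t in (Real.pi/3)..(Real.pi/2), Real.exp (-c * (9/16)) := by
    apply intervalIntegral.integral_mono_on (by linarith)
    · apply Continuous.intervalIntegrable; fun_prop
    · simp
    intro t ht
    obtain ⟨ht0, ht1⟩ := ht
    have h := Real.sin_le_sin_of_le_of_le_pi_div_two (by linarith) ht1 ht0
    rw [Real.sin_pi_div_three] at h
    have := pow_le_pow_left₀ (by positivity) h 4
    have e : (√3/2)^4 = 9/16 := by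
      rw [div_pow, show (√3)^4 = (√3^2)^2 by ring, Real.sq_sqrt (by norm_num)]; norm_num
    rw [e] at this
    apply Real.exp_le_exp.2
    nlinarith
  refine h1.trans (le_of_eq ?_)
  rw [intervalIntegral.integral_const, smul_eq_mul]; ring

theorem tailb (c : ℝ) (hc : 7 ≤ c) : c ^ (1/4 : ℝ) * Real.exp (-c * (9/16)) ≤ 0.04 := by
  have h1 : c ≤ 7 * Real.exp (c/7 - 1) := by have := Real.add_one_le_exp (c/7-1); linarith
  have hp : 0 ≤ c ^ (1/4 : ℝ) * Real.exp (-c * (9/16)) := by positivity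
  refine le_of_pow_le_pow_left₀ (n := 4) (by norm_num) (by norm_num) ?_
  rw [mul_pow, ← Real.rpow_natCast (c ^ (1/4:ℝ)) 4, ← Real.rpow_mul (by linarith), ← Real.exp_nat_mul]
  norm_num
  calc c * Real.exp (-(4 * (c * (9/16)))) ≤ (7 * Real.exp (c/7 - 1)) * Real.exp (-(4 * (c * (9/16)))) := by gcongr
    _ = 7 * Real.exp (c/7 - 1 -(4 * (c * (9/16)))) := by rw [mul_assoc, ← Real.exp_add]; ring_nf
    _ ≤ 7 * Real.exp (-15) := by gcongr; linarith
    _ ≤ _ := by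
      have h : (2.7182 : ℝ)^15 ≤ Real.exp 15 := by
        have := Real.exp_one_gt_d9
        have e : Real.exp 15 = Real.exp 1 ^ 15 := by rw [← Real.exp_nat_mul]; norm_num
        rw [e]
        exact pow_le_pow_left₀ (by norm_num) (by linarith) 15
      rw [Real.exp_neg, ← div_eq_mul_inv, div_le_iff₀ (Real.exp_pos _)]
      norm_num at h ⊢
      linarith

theorem Jbound (c : ℝ) (hc : 7 ≤ c) :
    c ^ (1/4 : ℝ) * ∫ θ in (0:ℝ)..Real.pi, Real.exp (-c * ((1 - Real.cos θ) / 2) ^ 2) ≤ 2.07 := by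
  have hc0 : 0 < c := by linarith
  have e1 : ∫ θ in (0:ℝ)..Real.pi, Real.exp (-c * ((1 - Real.cos θ) / 2) ^ 2) =
     2 * ∫ t in (0:ℝ)..(Real.pi/2), Real.exp (-c * Real.sin t ^ 4) := by
    have := intervalIntegral.integral_comp_div (a := 0) (b := Real.pi) (fun t => Real.exp (-c * Real.sin t ^ 4)) (two_ne_zero)
    rw [zero_div, smul_eq_mul] at this
    rw [← this]
    congr 1; ext θ
    congr 2
    have h := Real.cos_two_mul (θ/2)
    have h2 := Real.sin_sq_add_cos_sq (θ/2)
    rw [show 2 * (θ/2) = θ by ring] at h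
    have : (1 - Real.cos θ)/2 = Real.sin (θ/2)^2 := by linarith
    rw [this]; ring
  have ci : ∀ a b, IntervalIntegrable (fun t => Real.exp (-c * Real.sin t ^ 4)) volume a b := by
    intro a b; apply Continuous.intervalIntegrable; fun_prop
  rw [e1, ← intervalIntegral.integral_add_adjacent_intervals (ci 0 (Real.pi/3)) (ci _ _)]
  have j1 := J1 c hc0
  rw [(Gint c hc0).2] at j1
  have j2 := J2 c hc0
  have t := tailb c hc
  have g1 := Gamma_54
  have g2 := Gamma_34
  have gp := Real.Gamma_pos_of_pos (show (0:ℝ) < 5/4 by norm_num)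
  have gp' := Real.Gamma_pos_of_pos (show (0:ℝ) < 3/4 by norm_num)
  have m1 : c ^ (1/4:ℝ) * c ^ (-(1/4):ℝ) = 1 := by rw [← Real.rpow_add hc0]; norm_num
  have m3 : c ^ (1/4:ℝ) * c ^ (-(3/4):ℝ) ≤ 0.378 := by
    rw [← Real.rpow_add hc0, show (1/4 + -(3/4) : ℝ) = -(1/2) by norm_num, Real.rpow_neg hc0.le, ← Real.sqrt_eq_rpow]
    have : 1/0.378 ≤ √c := by
      apply Real.le_sqrt_of_sq_le; norm_num; linarith
    exact inv_le_of_inv_le₀ (by norm_num) (by rw [← one_div]; exact this)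
  have m5 : c ^ (1/4:ℝ) * c ^ (-(5/4):ℝ) ≤ 1/7 := by
    rw [← Real.rpow_add hc0, show (1/4 + -(5/4) : ℝ) = -1 by norm_num, Real.rpow_neg_one, ← one_div]
    exact one_div_le_one_div_of_le (by norm_num) hc
  have m0 : 0 < c ^ (1/4:ℝ) := by positivity
  have hpi := Real.pi_lt_d6
  calc _ ≤ c ^ (1/4:ℝ) * (2 * ((c ^ (-(1/4) : ℝ) * Real.Gamma (5/4) + c ^ (-(3/4) : ℝ) * (1/8) * Real.Gamma (3/4)
       + c ^ (-(5/4) : ℝ) * (5/18) * Real.Gamma (5/4)) + Real.pi/6 * Real.exp (-c * (9/16)))) := by gcongr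
    _ = 2 * (c ^ (1/4:ℝ) * c ^ (-(1/4):ℝ)) * Real.Gamma (5/4) + 1/4 * (c ^ (1/4:ℝ) * c ^ (-(3/4):ℝ)) * Real.Gamma (3/4)
       + 5/9 * (c ^ (1/4:ℝ) * c ^ (-(5/4):ℝ)) * Real.Gamma (5/4) + Real.pi/3 * (c ^ (1/4:ℝ) * Real.exp (-c * (9/16))) := by ring
    _ ≤ 2 * 1 * 0.917 + 1/4 * 0.378 * 1.2554 + 5/9 * (1/7) * 0.917 + 3.141593/3 * 0.04 := by
      rw [m1]; gcongr
    _ ≤ 2.07 := by norm_num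

theorem small1 (u : ℝ) (hu : 0 ≤ u) : 2*u ≤ 1.09^2 * 1 * Real.exp u := by
  have h := Real.sum_le_exp_of_nonneg hu 5
  norm_num [Finset.sum_range_succ, Nat.factorial] at h
  have key : ∀ (k : ℕ) (c : ℝ), 0 ≤ u ^ k * (u - c) ^ 2 := fun k c => by positivity
  have mon : ∀ k : ℕ, 0 ≤ u ^ k := fun k => by positivity
  linarith [key 0 1, key 0 2, key 1 1, key 1 2, key 2 1, key 2 2, mon 1, mon 2, mon 3, mon 4]

theorem small2 (u : ℝ) (hu : 0 ≤ u) : (2*u-1)^2 ≤ 1.09^2 * 2 * Real.exp u := by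
  have h := Real.sum_le_exp_of_nonneg hu 7
  norm_num [Finset.sum_range_succ, Nat.factorial] at h
  have key : ∀ (k : ℕ) (c : ℝ), 0 ≤ u ^ k * (u - c) ^ 2 := fun k c => by positivity
  have mon : ∀ k : ℕ, 0 ≤ u ^ k := fun k => by positivity
  linarith [key 0 1, key 0 2, key 0 3, key 0 4, key 1 1, key 1 2, key 1 3, key 1 4, key 2 1, key 2 2, key 2 3, key 2 4, key 3 1, key 3 2, key 3 3, key 3 4, key 4 1, key 4 2, key 4 3, key 4 4, mon 1, mon 2, mon 3, mon 4, mon 5, mon 6]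

theorem small3 (u : ℝ) (hu : 0 ≤ u) : 2*u*(2*u-3)^2 ≤ 1.09^2 * 6 * Real.exp u := by
  have h := Real.sum_le_exp_of_nonneg hu 9
  norm_num [Finset.sum_range_succ, Nat.factorial] at h
  have key : ∀ (k : ℕ) (c : ℝ), 0 ≤ u ^ k * (u - c) ^ 2 := fun k c => by positivity
  have mon : ∀ k : ℕ, 0 ≤ u ^ k := fun k => by positivity
  linarith [key 0 1, key 0 2, key 0 3, key 0 4, key 0 5, key 0 6, key 1 1, key 1 2, key 1 3, key 1 4, key 1 5, key 1 6, key 2 1, key 2 2, key 2 3, key 2 4, key 2 5, key 2 6, key 3 1, key 3 2, key 3 3, key 3 4, key 3 5, key 3 6, key 4 1, key 4 2, key 4 3, key 4 4, key 4 5, key 4 6, key 5 1, key 5 2, key 5 3, key 5 4, key 5 5, key 5 6, key 6 1, key 6 2, key 6 3, key 6 4, key 6 5, key 6 6, mon 1, mon 2, mon 3, mon 4, mon 5, mon 6, mon 7, mon 8]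

theorem small4 (u : ℝ) (hu : 0 ≤ u) : (4*u^2-12*u+3)^2 ≤ 1.09^2 * 24 * Real.exp u := by
  have h := Real.sum_le_exp_of_nonneg hu 11
  norm_num [Finset.sum_range_succ, Nat.factorial] at h
  have key : ∀ (a b : ℝ), a ≤ u → u ≤ b → ∀ i j : ℕ, 0 ≤ (u - a) ^ i * (b - u) ^ j := fun a b ha hb i j =>
    mul_nonneg (pow_nonneg (sub_nonneg.2 ha) _) (pow_nonneg (sub_nonneg.2 hb) _)
  have key2 : ∀ (a : ℝ), a ≤ u → ∀ i : ℕ, 0 ≤ (u - a) ^ i := fun a ha i =>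
    pow_nonneg (sub_nonneg.2 ha) _
  rcases le_total u (4) with h1 | h1
  · have k := key (0) (4) (by linarith) h1
    linarith [k 0 10, k 1 9, k 2 8, k 3 7, k 4 6, k 5 5, k 6 4, k 7 3, k 8 2, k 9 1, k 10 0]
  have k := key2 (4) h1
  linarith [k 0, k 1, k 2, k 3, k 4, k 5, k 6, k 7, k 8, k 9, k 10]

theorem small5 (u : ℝ) (hu : 0 ≤ u) : 2*u*(4*u^2-20*u+15)^2 ≤ 1.09^2 * 120 * Real.exp u := by
  have h := Real.sum_le_exp_of_nonneg hu 13
  norm_num [Finset.sum_range_succ, Nat.factorial] at h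
  have key : ∀ (a b : ℝ), a ≤ u → u ≤ b → ∀ i j : ℕ, 0 ≤ (u - a) ^ i * (b - u) ^ j := fun a b ha hb i j =>
    mul_nonneg (pow_nonneg (sub_nonneg.2 ha) _) (pow_nonneg (sub_nonneg.2 hb) _)
  have key2 : ∀ (a : ℝ), a ≤ u → ∀ i : ℕ, 0 ≤ (u - a) ^ i := fun a ha i =>
    pow_nonneg (sub_nonneg.2 ha) _
  rcases le_total u (5) with h1 | h1
  · have k := key (0) (5) (by linarith) h1
    linarith [k 0 12, k 1 11, k 2 10, k 3 9, k 4 8, k 5 7, k 6 6, k 7 5, k 8 4, k 9 3, k 10 2, k 11 1, k 12 0]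
  have k := key2 (5) h1
  linarith [k 0, k 1, k 2, k 3, k 4, k 5, k 6, k 7, k 8, k 9, k 10, k 11, k 12]

theorem small6 (u : ℝ) (hu : 0 ≤ u) : (8*u^3-60*u^2+90*u-15)^2 ≤ 1.09^2 * 720 * Real.exp u := by
  have h := Real.sum_le_exp_of_nonneg hu 15
  norm_num [Finset.sum_range_succ, Nat.factorial] at h
  have key : ∀ (a b : ℝ), a ≤ u → u ≤ b → ∀ i j : ℕ, 0 ≤ (u - a) ^ i * (b - u) ^ j := fun a b ha hb i j =>
    mul_nonneg (pow_nonneg (sub_nonneg.2 ha) _) (pow_nonneg (sub_nonneg.2 hb) _)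
  have key2 : ∀ (a : ℝ), a ≤ u → ∀ i : ℕ, 0 ≤ (u - a) ^ i := fun a ha i =>
    pow_nonneg (sub_nonneg.2 ha) _
  rcases le_total u (5) with h1 | h1
  · have k := key (0) (5) (by linarith) h1
    linarith [k 0 14, k 1 13, k 2 12, k 3 11, k 4 10, k 5 9, k 6 8, k 7 7, k 8 6, k 9 5, k 10 4, k 11 3, k 12 2, k 13 1, k 14 0]
  have k := key2 (5) h1
  linarith [k 0, k 1, k 2, k 3, k 4, k 5, k 6, k 7, k 8, k 9, k 10, k 11, k 12, k 13, k 14]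

theorem sq_reduce (n : ℕ) (x : ℝ)
    (h : (Polynomial.aeval x (Polynomial.hermite n)) ^ 2 ≤ 1.09 ^ 2 * n.factorial * Real.exp (x ^ 2 / 2)) :
    |Hnorm n x| ≤ 1.09 * Real.exp (x ^ 2 / 4) := by
  have hf : (0:ℝ) < n.factorial := by exact_mod_cast n.factorial_pos
  apply abs_le_of_sq_le_sq _ (by positivity)
  have e : Real.exp (x^2/4) ^ 2 = Real.exp (x^2/2) := by rw [← Real.exp_nat_mul]; congr 1; push_cast; ring
  rw [Hnorm, div_pow, Real.sq_sqrt hf.le, div_le_iff₀ hf, mul_pow, e]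
  linarith

theorem large_case (n : ℕ) (hn : 7 ≤ n) (x : ℝ) :
    |Hnorm n x| ≤ 1.09 * Real.exp (x ^ 2 / 4) := by
  have hc : (7:ℝ) ≤ n := by exact_mod_cast hn
  have hc0 : (0:ℝ) < n := by linarith
  have hpi := Real.pi_pos
  have hf : (0:ℝ) < n.factorial := by exact_mod_cast n.factorial_pos
  set R := √(n:ℝ) with hR
  have hR0 : 0 < R := Real.sqrt_pos.2 hc0
  have hR2 : R ^ 2 = n := Real.sq_sqrt hc0.le
  have h1 := cauchy_hermite n x R hR0
  set a := x / (2 * R) with ha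
  have hint : ∫ θ in (0:ℝ)..2 * Real.pi,
        Real.exp (x ^ 2 / 4 + R ^ 2 / 2 - (R * Real.cos θ + x / 2) ^ 2) =
      Real.exp (x ^ 2 / 4) * Real.exp (n / 2) * (2 * ∫ θ in (0:ℝ)..Real.pi, Real.exp (-(n:ℝ) * (Real.cos θ + a) ^ 2)) := by
    have e : ∀ θ, Real.exp (x ^ 2 / 4 + R ^ 2 / 2 - (R * Real.cos θ + x / 2) ^ 2) =
        Real.exp (x ^ 2 / 4) * Real.exp (n / 2) * Real.exp (-(n:ℝ) * (Real.cos θ + a) ^ 2) := by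
      intro θ
      rw [← Real.exp_add, ← Real.exp_add]
      congr 1
      rw [← hR2, ha]
      field_simp
      ring
    simp_rw [e]
    rw [intervalIntegral.integral_const_mul]
    congr 1
    have ci : ∀ a' b', IntervalIntegrable (fun θ => Real.exp (-(n:ℝ) * (Real.cos θ + a) ^ 2)) volume a' b' := by
      intro a' b'; apply Continuous.intervalIntegrable; fun_prop
    rw [← intervalIntegral.integral_add_adjacent_intervals (ci 0 Real.pi) (ci Real.pi (2 * Real.pi))]
    have := intervalIntegral.integral_comp_sub_left (a := 0) (b := Real.pi) (fun θ => Real.exp (-(n:ℝ) * (Real.cos θ + a) ^ 2)) (2 * Real.pi)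
    simp only [Real.cos_two_pi_sub] at this
    rw [show 2 * Real.pi - Real.pi = Real.pi by ring, sub_zero] at this
    linarith
  rw [hint] at h1
  have h2 := rearr n a hc0
  have h3 := Jbound n hc
  set I := ∫ θ in (0:ℝ)..Real.pi, Real.exp (-(n:ℝ) * (Real.cos θ + a) ^ 2)
  set q := (n:ℝ) ^ (1/4 : ℝ) with hq
  have hq0 : 0 < q := by positivity
  have hI : q * I ≤ 2.07 := (mul_le_mul_of_nonneg_left h2 hq0.le).trans h3
  have hI0 : 0 ≤ I := intervalIntegral.integral_nonneg hpi.le fun _ _ => (Real.exp_pos _).le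
  have hst : (n.factorial : ℝ) * Real.exp n ≤ Real.exp 1 * R * n ^ n := by
    have h := Stirling.stirlingSeq'_antitone (Nat.zero_le (n - 1))
    simp only [Function.comp, Nat.succ_eq_add_one, Nat.sub_add_cancel (show 1 ≤ n by omega), zero_add, Stirling.stirlingSeq_one] at h
    rw [Stirling.stirlingSeq, div_pow, Real.sqrt_mul (by norm_num), ← Real.exp_nat_mul, mul_one] at h
    rw [div_le_iff₀ (by positivity)] at h
    have s2 : (0:ℝ) < √2 := by positivity
    have e1 : Real.exp 1 / √2 * (√2 * √(n:ℝ) * ((n:ℝ) ^ n / Real.exp n)) = Real.exp 1 * R * n ^ n / Real.exp n := by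
      rw [← hR]
      field_simp
    rw [e1, le_div_iff₀ (Real.exp_pos _)] at h
    exact h
  have hqR : q ^ 2 = R := by
    rw [hq, hR, ← Real.rpow_natCast, ← Real.rpow_mul hc0.le, Real.sqrt_eq_rpow]; norm_num
  apply sq_reduce
  have h4 : |Polynomial.aeval x (Polynomial.hermite n)| ^ 2 ≤ _ := pow_le_pow_left₀ (abs_nonneg _) h1 2
  rw [sq_abs] at h4
  refine h4.trans ?_
  have e2 : Real.exp (x^2/4) ^ 2 = Real.exp (x^2/2) := by rw [← Real.exp_nat_mul]; congr 1; push_cast; ring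
  have e3 : Real.exp (n/2) ^ 2 = Real.exp n := by rw [← Real.exp_nat_mul]; congr 1; push_cast; ring
  have e4 : (R⁻¹ ^ n) ^ 2 * (n:ℝ) ^ n = 1 := by
    rw [← hR2, ← pow_mul, ← pow_mul, mul_comm n 2, ← mul_pow, inv_mul_cancel₀ hR0.ne', one_pow]
  have e5 : (↑n.factorial * ((2 * Real.pi)⁻¹ * (Real.exp (x ^ 2 / 4) * Real.exp (↑n / 2) * (2 * I))) * R⁻¹ ^ n) ^ 2
      = (n.factorial * Real.exp n) * (n.factorial * Real.exp (x^2/2) * (I / Real.pi)^2 * (R⁻¹ ^ n) ^ 2) := by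
    rw [← e2, ← e3]; field_simp
  rw [e5]
  calc _ ≤ (Real.exp 1 * R * n ^ n) * (n.factorial * Real.exp (x^2/2) * (I / Real.pi)^2 * (R⁻¹ ^ n) ^ 2) := by gcongr
    _ = (Real.exp 1 * (q * I / Real.pi)^2) * n.factorial * Real.exp (x^2/2) * ((R⁻¹ ^ n) ^ 2 * (n:ℝ) ^ n) := by
      rw [← hqR]; ring
    _ = (Real.exp 1 * (q * I / Real.pi)^2) * n.factorial * Real.exp (x^2/2) := by rw [e4, mul_one]
    _ ≤ 1.09 ^ 2 * n.factorial * Real.exp (x^2/2) := by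
      gcongr
      have b1 : q * I / Real.pi ≤ 2.07 / 3.14159 := by
        gcongr
        exact Real.pi_gt_d6.le.trans' (by norm_num)
      have b0 : 0 ≤ q * I / Real.pi := by positivity
      calc Real.exp 1 * (q * I / Real.pi)^2 ≤ 2.7182818286 * (2.07 / 3.14159)^2 := by
            gcongr
            exact Real.exp_one_lt_d9.le
        _ ≤ _ := by norm_num

/-- Cramér-type bound: `|H_n(x)| ≤ 1.09 e^{x²/4}` for the orthonormal probabilists'
Hermite polynomials. -/
theorem hermite_cramer_bound (n : ℕ) (x : ℝ) :
    |Hnorm n x| ≤ 1.09 * Real.exp (x ^ 2 / 4) := by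
  rcases le_or_gt 7 n with hn | hn
  · exact large_case n hn x
  apply sq_reduce
  have hu : 0 ≤ x ^ 2 / 2 := by positivity
  have h0 : Polynomial.aeval x (Polynomial.hermite 0) = 1 := by simp
  have h1 : Polynomial.aeval x (Polynomial.hermite 1) = x := by simp
  have h2 : Polynomial.aeval x (Polynomial.hermite 2) = x^2 - 1 := by
    simp [Polynomial.hermite_succ]; ring
  have h3 : Polynomial.aeval x (Polynomial.hermite 3) = x^3 - 3*x := by
    simp [Polynomial.hermite_succ]; ring
  have h4 : Polynomial.aeval x (Polynomial.hermite 4) = x^4 - 6*x^2 + 3 := by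
    simp [Polynomial.hermite_succ]; ring
  have h5 : Polynomial.aeval x (Polynomial.hermite 5) = x^5 - 10*x^3 + 15*x := by
    simp [Polynomial.hermite_succ]; ring
  have h6 : Polynomial.aeval x (Polynomial.hermite 6) = x^6 - 15*x^4 + 45*x^2 - 15 := by
    simp [Polynomial.hermite_succ]; ring
  interval_cases n
  · rw [h0]
    have := Real.one_le_exp hu
    norm_num [Nat.factorial]; linarith
  · rw [h1]
    refine le_trans (le_of_eq ?_) ((small1 _ hu).trans (le_of_eq ?_))
    · ring
    · norm_num [Nat.factorial]
  · rw [h2]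
    refine le_trans (le_of_eq ?_) ((small2 _ hu).trans (le_of_eq ?_))
    · ring
    · norm_num [Nat.factorial]
  · rw [h3]
    refine le_trans (le_of_eq ?_) ((small3 _ hu).trans (le_of_eq ?_))
    · ring
    · norm_num [Nat.factorial]
  · rw [h4]
    refine le_trans (le_of_eq ?_) ((small4 _ hu).trans (le_of_eq ?_))
    · ring
    · norm_num [Nat.factorial]
  · rw [h5]
    refine le_trans (le_of_eq ?_) ((small5 _ hu).trans (le_of_eq ?_))
    · ring
    · norm_num [Nat.factorial]
  · rw [h6]
    refine le_trans (le_of_eq ?_) ((small6 _ hu).trans (le_of_eq ?_))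
    · ring
    · norm_num [Nat.factorial]
end

section
/- Let f(x) = e^{x²/4}. For every natural number m and every real x, the derivative of even order 2m of f is nonnegative: f^{(2m)}(x) ≥ 0. -/
open MeasureTheory ProbabilityTheory

variable {E : Type*} [NormedAddCommGroup E] [NormedSpace ℝ E]

open Polynomial in
lemma aux_deriv_step (q : Polynomial ℝ) (hq : ∀ n, 0 ≤ q.coeff n) :
    ∃ r : Polynomial ℝ, (∀ n, 0 ≤ r.coeff n) ∧
      deriv (fun x : ℝ => q.eval (x ^ 2) * Real.exp (x ^ 2 / 4)) =
        fun x : ℝ => x * r.eval (x ^ 2) * Real.exp (x ^ 2 / 4) := by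
  refine ⟨C 2 * derivative q + C (1 / 2) * q, ?_, ?_⟩
  · intro n
    have h1 := hq n
    have h2 := hq (n + 1)
    simp only [coeff_add, coeff_C_mul, coeff_derivative]
    positivity
  · funext x
    have h1 : HasDerivAt (fun x : ℝ => x ^ 2) (2 * x) x := by
      simpa using hasDerivAt_pow 2 x
    have h2 := (q.hasDerivAt (x ^ 2)).comp x h1
    have h3 := (h1.div_const 4).exp
    have h4 := h2.mul h3
    refine h4.deriv.trans ?_
    simp only [eval_add, eval_mul, eval_C, Function.comp]
    ring

lemma aux_second_deriv (m : ℕ) :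
    ∃ q : Polynomial ℝ, (∀ n, 0 ≤ q.coeff n) ∧
      iteratedDeriv (2 * m) (fun x : ℝ => Real.exp (x ^ 2 / 4)) =
        fun x : ℝ => q.eval (x ^ 2) * Real.exp (x ^ 2 / 4) := by
  induction m with
  | zero =>
    refine ⟨1, fun n => ?_, ?_⟩
    · rw [Polynomial.coeff_one]; split_ifs <;> norm_num
    · funext x; simp
  | succ m ih =>
    obtain ⟨q, hq, e⟩ := ih
    obtain ⟨r, hr, e1⟩ := aux_deriv_step q hq
    obtain ⟨t, ht, e2⟩ := aux_deriv_step r hr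
    refine ⟨r + Polynomial.X * t, fun n => ?_, ?_⟩
    · have h1 := hr n
      cases n with
      | zero => simpa using h1
      | succ n =>
        have h2 := ht n
        simp only [Polynomial.coeff_add, Polynomial.coeff_X_mul]
        positivity
    · rw [show 2 * (m + 1) = 2 * m + 1 + 1 by ring, iteratedDeriv_succ, iteratedDeriv_succ, e, e1]
      funext x
      have hd : DifferentiableAt ℝ
          (fun x : ℝ => r.eval (x ^ 2) * Real.exp (x ^ 2 / 4)) x := by
        have : DifferentiableAt ℝ (fun x : ℝ => r.eval (x ^ 2)) x :=
          DifferentiableAt.comp x r.differentiableAt (by fun_prop)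
        fun_prop
      have h := (hasDerivAt_id x).mul hd.hasDerivAt
      rw [e2] at h
      have e3 : (fun x : ℝ => x * r.eval (x ^ 2) * Real.exp (x ^ 2 / 4)) =
          id * (fun x : ℝ => r.eval (x ^ 2) * Real.exp (x ^ 2 / 4)) := by
        funext y; simp [mul_assoc]
      rw [e3]
      refine h.deriv.trans ?_
      simp only [Polynomial.eval_add, Polynomial.eval_mul, Polynomial.eval_X, id]
      ring

/-- Every even-order derivative of `f(x) = e^{x²/4}` is nonnegative. -/
theorem even_deriv_exp_sq_quarter_nonneg (m : ℕ) (x : ℝ) :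
    0 ≤ iteratedDeriv (2 * m) (fun x : ℝ => Real.exp (x ^ 2 / 4)) x := by
  obtain ⟨q, hq, e⟩ := aux_second_deriv m
  rw [e]
  refine mul_nonneg ?_ (Real.exp_pos _).le
  rw [Polynomial.eval_eq_sum_range]
  exact Finset.sum_nonneg fun i _ => mul_nonneg (hq i) (by positivity)
end

section
/- Fix l ∈ ℕ. Let y_0, …, y_l be the l+1 distinct real roots of the orthonormal probabilists' Hermite polynomial H_{l+1}, and define the Gauss–Hermite weights w_k = 1/((l+1)² · H_l(y_k)²) for k = 0, …, l. Then for every natural number n, the quadrature of H_n is bounded: |Σ_{k=0}^{l} w_k H_n(y_k)| < 2 (indeed it is at most √2 · 1.086436 < 2). -/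
open MeasureTheory ProbabilityTheory

variable {E : Type*} [NormedAddCommGroup E] [NormedSpace ℝ E]

lemma GH_poly_deriv (n : ℕ) : Polynomial.derivative (Polynomial.hermite (n + 1)) =
    (n + 1 : Polynomial ℤ) * Polynomial.hermite n := by
  induction n with
  | zero => simp [Polynomial.hermite_succ]
  | succ n ih =>
    have h1 := Polynomial.hermite_succ (n + 1)
    have h2 := Polynomial.hermite_succ n
    rw [h1, ih]
    simp only [Polynomial.derivative_sub, Polynomial.derivative_mul, Polynomial.derivative_X, ih]
    have h3 : Polynomial.derivative ((n : Polynomial ℤ) + 1) = 0 := by simp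
    rw [h3]
    push_cast
    linear_combination (-(n + 1 : Polynomial ℤ)) * h2

lemma GH_fac (n : ℕ) : Real.sqrt ((n + 1).factorial) =
    Real.sqrt ((n : ℝ) + 1) * Real.sqrt (n.factorial) := by
  rw [Nat.factorial_succ]; push_cast
  rw [Real.sqrt_mul (by positivity)]

lemma GH_D1 (n : ℕ) (x : ℝ) :
    HasDerivAt (Hnorm n) (x * Hnorm n x - Real.sqrt ((n : ℝ) + 1) * Hnorm (n + 1) x) x := by
  have h := ((Polynomial.hermite n).hasDerivAt_aeval x).div_const (Real.sqrt (n.factorial))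
  refine HasDerivAt.congr_deriv h ?_
  unfold Hnorm
  rw [GH_fac, Polynomial.hermite_succ]
  have h1 : Real.sqrt ((n : ℝ) + 1) ≠ 0 := by positivity
  have h2 : Real.sqrt (n.factorial) ≠ 0 := by positivity
  simp only [map_sub, map_mul, Polynomial.aeval_X]
  field_simp
  ring

lemma GH_D2 (n : ℕ) (x : ℝ) :
    HasDerivAt (Hnorm (n + 1)) (Real.sqrt ((n : ℝ) + 1) * Hnorm n x) x := by
  have h := ((Polynomial.hermite (n + 1)).hasDerivAt_aeval x).div_const
    (Real.sqrt ((n + 1).factorial))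
  refine HasDerivAt.congr_deriv h ?_
  unfold Hnorm
  rw [GH_fac, GH_poly_deriv]
  have h1 : Real.sqrt ((n : ℝ) + 1) ≠ 0 := by positivity
  have h2 : Real.sqrt (n.factorial) ≠ 0 := by positivity
  have h3 : Real.sqrt ((n : ℝ) + 1) ^ 2 = n + 1 := Real.sq_sqrt (by positivity)
  simp only [map_add, map_mul, map_natCast, map_one]
  field_simp
  rw [h3]
  ring

lemma GH_zero (x : ℝ) : Hnorm 0 x = 1 := by simp [Hnorm]

lemma GH_one (x : ℝ) : Hnorm 1 x = x := by simp [Hnorm]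

lemma GH_rec (n : ℕ) (x : ℝ) : Real.sqrt ((n : ℝ) + 2) * Hnorm (n + 2) x =
    x * Hnorm (n + 1) x - Real.sqrt ((n : ℝ) + 1) * Hnorm n x := by
  have h := (GH_D1 (n + 1) x).unique (GH_D2 n x)
  have e : ((n + 1 : ℕ) : ℝ) + 1 = n + 2 := by push_cast; ring
  rw [e] at h
  linarith

/-- recurrence without truncated indices issues -/
lemma GH_xmul (n : ℕ) (x : ℝ) : x * Hnorm n x =
    Real.sqrt ((n : ℝ) + 1) * Hnorm (n + 1) x + Real.sqrt n * Hnorm (n - 1) x := by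
  cases n with
  | zero => simp [GH_zero, GH_one]
  | succ n =>
    have := GH_rec n x
    have e : ((n + 1 : ℕ) : ℝ) + 1 = n + 2 := by push_cast; ring
    rw [e, Nat.add_sub_cancel]; push_cast; linarith

lemma GH_CD (m : ℕ) (x y : ℝ) :
    (∑ j ∈ Finset.range (m + 1), Hnorm j x * Hnorm j y) * (x - y) =
    Real.sqrt ((m : ℝ) + 1) * (Hnorm (m + 1) x * Hnorm m y - Hnorm m x * Hnorm (m + 1) y) := by
  induction m with
  | zero => simp [GH_zero, GH_one]
  | succ m ih =>
    rw [Finset.sum_range_succ, add_mul, ih]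
    have h1 := GH_rec m x
    have h2 := GH_rec m y
    have e : ((m + 1 : ℕ) : ℝ) + 1 = m + 2 := by push_cast; ring
    rw [e]
    linear_combination (-Hnorm (m + 1) y) * h1 + Hnorm (m + 1) x * h2

lemma GH_CDdiag (m : ℕ) (x : ℝ) :
    (∑ j ∈ Finset.range (m + 2), Hnorm j x ^ 2) =
    (m + 2) * Hnorm (m + 1) x ^ 2 -
      Real.sqrt ((m : ℝ) + 2) * Real.sqrt ((m : ℝ) + 1) * Hnorm (m + 2) x * Hnorm m x := by
  induction m with
  | zero =>
    have h := GH_rec 0 x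
    simp [Finset.sum_range_succ, GH_zero, GH_one] at *
    linear_combination h
  | succ m ih =>
    rw [Finset.sum_range_succ, ih]
    have h1 := GH_rec m x
    have h2 := GH_rec (m + 1) x
    have e : ((m + 1 : ℕ) : ℝ) + 1 = m + 2 := by push_cast; ring
    have e' : ((m + 1 : ℕ) : ℝ) + 2 = m + 3 := by push_cast; ring
    rw [e, e'] at h2
    rw [e, e']
    have s1 : Real.sqrt ((m : ℝ) + 2) ^ 2 = m + 2 := Real.sq_sqrt (by positivity)
    push_cast
    simp only [show m + 1 + 1 = m + 2 from rfl] at h2 ⊢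
    linear_combination (Real.sqrt ((m : ℝ) + 2) * Hnorm (m + 1) x) * h2 -
      Real.sqrt ((m : ℝ) + 2) * Hnorm (m + 2) x * h1 
       + (Hnorm (m + 2) x ^ 2 - Hnorm (m + 1) x ^ 2) * s1

lemma GH_diag_root (l : ℕ) (x : ℝ) (hx : Hnorm (l + 1) x = 0) :
    (∑ j ∈ Finset.range (l + 1), Hnorm j x ^ 2) = (l + 1) * Hnorm l x ^ 2 := by
  cases l with
  | zero => simp [GH_zero]
  | succ m =>
    rw [GH_CDdiag, show m + 2 = m + 1 + 1 from rfl, hx]; push_cast; ring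

lemma GH_pos_root (l : ℕ) (x : ℝ) (hx : Hnorm (l + 1) x = 0) :
    0 < ((l : ℝ) + 1) * Hnorm l x ^ 2 := by
  rw [← GH_diag_root l x hx, Finset.sum_range_succ']
  have : 0 ≤ ∑ k ∈ Finset.range l, Hnorm (k + 1) x ^ 2 := Finset.sum_nonneg (fun _ _ => sq_nonneg _)
  rw [GH_zero]; linarith

lemma GH_root_bound (l : ℕ) (x : ℝ) (hx : Hnorm (l + 1) x = 0) : x ^ 2 ≤ 4 * l := by
  have key : ∀ m : ℕ, x * ∑ j ∈ Finset.range (m + 1), Hnorm j x ^ 2 =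
      2 * ∑ j ∈ Finset.range m, Real.sqrt ((j : ℝ) + 1) * (Hnorm j x * Hnorm (j + 1) x) +
      Real.sqrt ((m : ℝ) + 1) * (Hnorm m x * Hnorm (m + 1) x) := by
    intro m
    induction m with
    | zero => simp [GH_zero, GH_one]
    | succ m ih =>
      rw [Finset.sum_range_succ, mul_add, ih, Finset.sum_range_succ]
      have h1 := GH_rec m x
      have e : ((m + 1 : ℕ) : ℝ) + 1 = m + 2 := by push_cast; ring
      rw [e]
      linear_combination (-Hnorm (m + 1) x) * h1
  have k := key l
  rw [hx] at k
  set S := ∑ j ∈ Finset.range (l + 1), Hnorm j x ^ 2 with hS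
  have Spos : 0 < S := by rw [hS, GH_diag_root l x hx]; exact GH_pos_root l x hx
  have b : |2 * ∑ j ∈ Finset.range l, Real.sqrt ((j : ℝ) + 1) * (Hnorm j x * Hnorm (j + 1) x)|
      ≤ 2 * Real.sqrt l * S := by
    rw [abs_mul, abs_two, mul_assoc]
    refine mul_le_mul_of_nonneg_left ?_ (by norm_num)
    refine (Finset.abs_sum_le_sum_abs _ _).trans ?_
    have : ∀ j ∈ Finset.range l, |Real.sqrt ((j : ℝ) + 1) * (Hnorm j x * Hnorm (j + 1) x)| ≤
        Real.sqrt l * ((Hnorm j x ^ 2 + Hnorm (j + 1) x ^ 2) / 2) := by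
      intro j hj
      rw [abs_mul, abs_of_nonneg (Real.sqrt_nonneg _)]
      refine mul_le_mul (Real.sqrt_le_sqrt ?_) ?_ (abs_nonneg _) (Real.sqrt_nonneg _)
      · exact_mod_cast Finset.mem_range.1 hj
      · rw [abs_le]; constructor
        · nlinarith [sq_nonneg (Hnorm j x + Hnorm (j + 1) x)]
        · nlinarith [sq_nonneg (Hnorm j x - Hnorm (j + 1) x)]
    refine (Finset.sum_le_sum this).trans ?_
    rw [← Finset.mul_sum]
    refine mul_le_mul_of_nonneg_left ?_ (Real.sqrt_nonneg _)
    rw [← Finset.sum_div, Finset.sum_add_distrib]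
    have a1 : S = (∑ j ∈ Finset.range l, Hnorm j x ^ 2) + Hnorm l x ^ 2 := by
      rw [hS, Finset.sum_range_succ]
    have a2 : S = (∑ j ∈ Finset.range l, Hnorm (j + 1) x ^ 2) + Hnorm 0 x ^ 2 := by
      rw [hS, Finset.sum_range_succ']
    nlinarith [sq_nonneg (Hnorm l x), sq_nonneg (Hnorm 0 x)]
  have b2 : |x| * S ≤ 2 * Real.sqrt l * S := by
    rw [← abs_of_pos Spos, ← abs_mul, k, abs_of_pos Spos]; simpa using b
  have b3 : |x| ≤ 2 * Real.sqrt l := le_of_mul_le_mul_right b2 Spos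
  have s := Real.sq_sqrt (show (0 : ℝ) ≤ l by positivity)
  rw [← sq_abs]
  nlinarith [abs_nonneg x]

/-- orthonormality of the discrete measure -/
lemma GH_orth (l : ℕ) (y : Fin (l + 1) → ℝ)
    (hy_inj : Function.Injective y)
    (hy_root : ∀ k, Hnorm (l + 1) (y k) = 0) (i j : Fin (l + 1)) :
    ∑ k, 1 / (((l : ℝ) + 1) * Hnorm l (y k) ^ 2) * (Hnorm i (y k) * Hnorm j (y k)) =
      if i = j then 1 else 0 := by
  let B : Matrix (Fin (l + 1)) (Fin (l + 1)) ℝ := Matrix.of fun k j => Hnorm j (y k)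
  let C : Matrix (Fin (l + 1)) (Fin (l + 1)) ℝ :=
    Matrix.of fun j k => Hnorm j (y k) * (1 / (((l : ℝ) + 1) * Hnorm l (y k) ^ 2))
  have h : B * C = 1 := by
    ext k m
    rw [Matrix.mul_apply, Matrix.one_apply]
    simp only [B, C, Matrix.of_apply]
    simp_rw [← mul_assoc]
    rw [← Finset.sum_mul, Fin.sum_univ_eq_sum_range (fun j => Hnorm j (y k) * Hnorm j (y m))]
    split_ifs with hkm
    · subst hkm
      have p := GH_pos_root l _ (hy_root k)
      simp_rw [← pow_two]
      rw [GH_diag_root l _ (hy_root k)]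
      exact mul_one_div_cancel p.ne'
    · have c := GH_CD l (y k) (y m)
      rw [hy_root, hy_root] at c
      have ne : y k - y m ≠ 0 := sub_ne_zero.2 (fun e => hkm (hy_inj e))
      have : ∑ j ∈ Finset.range (l + 1), Hnorm j (y k) * Hnorm j (y m) = 0 := by
        apply (mul_eq_zero.1 (c.trans (by ring))).resolve_right ne
      rw [this, zero_mul]
  have h2 : C * B = 1 := mul_eq_one_comm.1 h
  have h3 := congrFun (congrFun h2 i) j
  rw [Matrix.mul_apply, Matrix.one_apply] at h3
  rw [← h3]
  refine Finset.sum_congr rfl fun k _ => ?_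
  simp only [B, C, Matrix.of_apply]; ring

lemma GH_exact (l : ℕ) (y : Fin (l + 1) → ℝ)
    (hy_inj : Function.Injective y)
    (hy_root : ∀ k, Hnorm (l + 1) (y k) = 0) (m : ℕ) : ∀ i, i < m → i + m ≤ 2 * l + 1 →
    ∑ k, 1 / (((l : ℝ) + 1) * Hnorm l (y k) ^ 2) * (Hnorm i (y k) * Hnorm m (y k)) = 0 := by
  induction m using Nat.strong_induction_on with
  | _ m ih =>
    intro i him hi
    rcases lt_or_ge m (l + 1) with hm | hm
    · rw [GH_orth l y hy_inj hy_root ⟨i, by omega⟩ ⟨m, hm⟩, if_neg]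
      simp; omega
    rcases hm.eq_or_lt with rfl | hm
    · simp [hy_root]
    obtain ⟨p, rfl⟩ : ∃ p, m = p + 2 := ⟨m - 2, by omega⟩
    have s : Real.sqrt ((p : ℝ) + 2) ≠ 0 := by positivity
    have e : ∀ k, 1 / (((l : ℝ) + 1) * Hnorm l (y k) ^ 2) * (Hnorm i (y k) * Hnorm (p + 2) (y k)) =
      1 / Real.sqrt ((p : ℝ) + 2) * (
        Real.sqrt ((i : ℝ) + 1) * (1 / (((l : ℝ) + 1) * Hnorm l (y k) ^ 2) *
          (Hnorm (i + 1) (y k) * Hnorm (p + 1) (y k))) +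
        Real.sqrt i * (1 / (((l : ℝ) + 1) * Hnorm l (y k) ^ 2) *
          (Hnorm (i - 1) (y k) * Hnorm (p + 1) (y k))) -
        Real.sqrt ((p : ℝ) + 1) * (1 / (((l : ℝ) + 1) * Hnorm l (y k) ^ 2) *
          (Hnorm i (y k) * Hnorm p (y k)))) := by
      intro k
      have h1 := GH_rec p (y k)
      have h2 := GH_xmul i (y k)
      have h3 : Hnorm (p + 2) (y k) = 1 / Real.sqrt ((p : ℝ) + 2) *
          (y k * Hnorm (p + 1) (y k) - Real.sqrt ((p : ℝ) + 1) * Hnorm p (y k)) := by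
        rw [← h1]; field_simp
      rw [h3]
      linear_combination (1 / (((l : ℝ) + 1) * Hnorm l (y k) ^ 2) * (1 / Real.sqrt ((p : ℝ) + 2)) *
        Hnorm (p + 1) (y k)) * h2
    rw [Finset.sum_congr rfl (fun k _ => e k), ← Finset.mul_sum, Finset.sum_sub_distrib,
      Finset.sum_add_distrib, ← Finset.mul_sum, ← Finset.mul_sum, ← Finset.mul_sum,
      ih (p + 1) (by omega) (i + 1) (by omega) (by omega),
      ih (p + 1) (by omega) (i - 1) (by omega) (by omega),
      ih p (by omega) i (by omega) (by omega)]
    ring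

lemma GH_max {f f' : ℝ → ℝ} {a : ℝ} (hf : ∀ x, x ^ 2 ≤ a → HasDerivAt f (f' x) x)
    (h : ∀ x, x ^ 2 ≤ a → x * f' x ≤ 0) (x : ℝ) (hx : x ^ 2 ≤ a) : f x ≤ f 0 := by
  rcases lt_trichotomy x 0 with h0 | rfl | h0
  · obtain ⟨c, ⟨c1, c2⟩, hc⟩ := exists_hasDerivAt_eq_slope f f' h0
      (fun z hz => (hf z (by nlinarith [hz.1, hz.2])).continuousAt.continuousWithinAt)
      (fun z hz => hf z (by nlinarith [hz.1, hz.2]))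
    have := h c (by nlinarith)
    have h1 : 0 ≤ f' c := by by_contra! hh; nlinarith
    rw [hc] at h1
    have h2 : (f 0 - f x) / (0 - x) * (0 - x) = f 0 - f x := div_mul_cancel₀ _ (by linarith)
    nlinarith
  · exact le_rfl
  · obtain ⟨c, ⟨c1, c2⟩, hc⟩ := exists_hasDerivAt_eq_slope f f' h0
      (fun z hz => (hf z (by nlinarith [hz.1, hz.2])).continuousAt.continuousWithinAt)
      (fun z hz => hf z (by nlinarith [hz.1, hz.2]))
    have := h c (by nlinarith)
    have h1 : f' c ≤ 0 := by by_contra! hh; nlinarith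
    rw [hc] at h1
    have h2 : (f x - f 0) / (x - 0) * (x - 0) = f x - f 0 := div_mul_cancel₀ _ (by linarith)
    nlinarith

noncomputable def GHq (m : ℕ) (x : ℝ) : ℝ := (m : ℝ) + 3 / 2 - x ^ 2 / 4

/-- the energy of the Hermite function of index `m + 1` -/
noncomputable def GHG (m : ℕ) (x : ℝ) : ℝ :=
  Real.exp (-x ^ 2 / 2) * ((Real.sqrt ((m : ℝ) + 1) * Hnorm m x - x * Hnorm (m + 1) x / 2) ^ 2 +
    GHq m x * Hnorm (m + 1) x ^ 2)

lemma GHq_deriv (m : ℕ) (x : ℝ) : HasDerivAt (GHq m) (-x / 2) x := by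
  have := (((hasDerivAt_id x).pow 2).div_const 4).const_sub ((m : ℝ) + 3 / 2)
  refine this.congr_deriv ?_
  simp; ring

lemma GHG_deriv (m : ℕ) (x : ℝ) :
    HasDerivAt (GHG m) (Real.exp (-x ^ 2 / 2) * (-x / 2 * Hnorm (m + 1) x ^ 2)) x := by
  have hid := hasDerivAt_id x
  have h0 := GH_D1 m x
  have h1 := GH_D2 m x
  have he := ((hid.pow 2).neg.div_const 2).exp
  have := he.mul ((((h0.const_mul (Real.sqrt ((m : ℝ) + 1))).sub
    ((hid.mul h1).div_const 2)).pow 2).add ((GHq_deriv m x).mul (h1.pow 2)))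
  refine this.congr_deriv ?_
  have s1 : Real.sqrt ((m : ℝ) + 1) ^ 2 = m + 1 := Real.sq_sqrt (by positivity)
  simp [GHq]
  generalize Real.exp (-x ^ 2 / 2) = E at *
  generalize Real.sqrt ((m : ℝ) + 1) = s at *
  generalize Hnorm m x = A at *
  generalize Hnorm (m + 1) x = B at *
  have : (m : ℝ) = s ^ 2 - 1 := by linarith
  rw [this]
  ring

lemma GHG_le (m : ℕ) (x : ℝ) : GHG m x ≤ GHG m 0 := by
  refine GH_max (a := x ^ 2) (fun z _ => GHG_deriv m z) (fun z _ => ?_) x le_rfl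
  have : 0 ≤ Real.exp (-z ^ 2 / 2) * ((z * Hnorm (m + 1) z) ^ 2) := by positivity
  nlinarith

lemma GHS_ge (m : ℕ) (x : ℝ) (hx : x ^ 2 ≤ 4 * m) :
    GHG m 0 / GHq m 0 ≤ GHG m x / GHq m x := by
  have hq : ∀ z : ℝ, z ^ 2 ≤ 4 * m → 0 < GHq m z := by
    intro z hz; unfold GHq; linarith
  have := GH_max (a := 4 * (m : ℝ)) (f := fun z => -(GHG m z / GHq m z))
    (fun z hz => ((GHG_deriv m z).div (GHq_deriv m z) (hq z hz).ne').neg) (fun z hz => ?_) x hx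
  · linarith
  · have p := hq z hz
    rw [mul_neg, ← mul_div_assoc, neg_nonpos]
    refine div_nonneg ?_ (by positivity)
    have : 0 ≤ Real.exp (-z ^ 2 / 2) * (z *
      (Real.sqrt ((m : ℝ) + 1) * Hnorm m z - z * Hnorm (m + 1) z / 2)) ^ 2 := by positivity
    rw [GHG]
    nlinarith

lemma GH_c_rec (m : ℕ) : ((m : ℝ) + 2) * Hnorm (m + 2) 0 ^ 2 = (m + 1) * Hnorm m 0 ^ 2 := by
  have h := GH_rec m 0
  have s1 : Real.sqrt ((m : ℝ) + 1) ^ 2 = m + 1 := Real.sq_sqrt (by positivity)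
  have s2 : Real.sqrt ((m : ℝ) + 2) ^ 2 = m + 2 := Real.sq_sqrt (by positivity)
  rw [← s1, ← s2, ← mul_pow, h]; ring

lemma GH_c (k : ℕ) : Hnorm (2 * k + 1) 0 = 0 ∧ Hnorm (2 * k + 2) 0 ^ 2 ≤ 1 / 2 ∧
    1 ≤ (2 * (k : ℝ) + 2) * Hnorm (2 * k + 2) 0 ^ 2 := by
  induction k with
  | zero =>
    have h := GH_c_rec 0
    simp [GH_zero, GH_one] at *
    constructor <;> linarith
  | succ k ih =>
    obtain ⟨a, b, c⟩ := ih
    have h1 := GH_c_rec (2 * k + 1)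
    have h2 := GH_c_rec (2 * k + 2)
    rw [a] at h1
    have e1 : 2 * (k + 1) + 1 = 2 * k + 1 + 2 := by ring
    have e2 : 2 * (k + 1) + 2 = 2 * k + 2 + 2 := by ring
    rw [e1, e2]
    push_cast at *
    have p : (0 : ℝ) ≤ k := by positivity
    refine ⟨?_, ?_, ?_⟩
    · have : (2 * (k : ℝ) + 1 + 2) ≠ 0 := by positivity
      have h3 : Hnorm (2 * k + 1 + 2) 0 ^ 2 = 0 := by
        apply (mul_eq_zero.1 (h1.trans (by ring))).resolve_left this
      exact pow_eq_zero_iff (two_ne_zero) |>.1 h3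
    · nlinarith [sq_nonneg (Hnorm (2 * k + 2) 0), sq_nonneg (Hnorm (2 * k + 2 + 2) 0)]
    · nlinarith [sq_nonneg (Hnorm (2 * k + 2) 0), sq_nonneg (Hnorm (2 * k + 2 + 2) 0)]

lemma GHG_zero (m : ℕ) : GHG m 0 = (m + 1) * Hnorm m 0 ^ 2 + (m + 3 / 2) * Hnorm (m + 1) 0 ^ 2 := by
  have s1 : Real.sqrt ((m : ℝ) + 1) ^ 2 = m + 1 := Real.sq_sqrt (by positivity)
  simp [GHG, GHq, mul_pow, s1]

lemma GHG_zero_ge (m : ℕ) : 1 ≤ GHG m 0 := by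
  rw [GHG_zero]
  rcases Nat.even_or_odd' m with ⟨k, rfl | rfl⟩
  · have := (GH_c k).2.2
    have h := GH_c_rec (2 * k)
    have : 0 ≤ (((2 * k : ℕ) : ℝ) + 3 / 2) * Hnorm (2 * k + 1) 0 ^ 2 := by positivity
    push_cast at *
    linarith
  · obtain ⟨a, b, c⟩ := GH_c k
    rw [a]; push_cast
    simp only [show 2 * k + 1 + 1 = 2 * k + 2 from rfl]
    nlinarith [sq_nonneg (Hnorm (2 * k + 2) 0)]

lemma GHG_zero_le (m : ℕ) (hm : 1 ≤ m) : GHG m 0 ≤ (m + 3 / 2) / 2 := by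
  rw [GHG_zero]
  rcases Nat.even_or_odd' m with ⟨k, rfl | rfl⟩
  · obtain ⟨j, rfl⟩ : ∃ j, k = j + 1 := ⟨k - 1, by omega⟩
    have a := (GH_c (j + 1)).1
    have b := (GH_c j).2.1
    rw [a, show 2 * (j + 1) = 2 * j + 2 by ring]
    push_cast
    nlinarith [(Nat.cast_nonneg j : (0 : ℝ) ≤ j)]
  · obtain ⟨a, b, c⟩ := GH_c k
    rw [a]; push_cast
    simp only [show 2 * k + 1 + 1 = 2 * k + 2 from rfl]
    nlinarith [(Nat.cast_nonneg k : (0 : ℝ) ≤ k)]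

lemma GH_upper (l n : ℕ) (hn : 2 * l + 2 ≤ n) (x : ℝ) (hx : x ^ 2 ≤ 4 * l) :
    |Hnorm n x| ≤ Real.exp (x ^ 2 / 4) := by
  obtain ⟨m, rfl⟩ : ∃ m, n = m + 1 := ⟨n - 1, by omega⟩
  have h1 := GHG_le m x
  have h2 := GHG_zero_le m (by omega)
  have hml : 2 * (l : ℝ) + 1 ≤ m := by exact_mod_cast (by omega : 2 * l + 1 ≤ m)
  have hq : ((m : ℝ) + 3 / 2) / 2 ≤ GHq m x := by unfold GHq; linarith
  have hq0 : 0 < GHq m x := lt_of_lt_of_le (by positivity) hq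
  have e : Real.exp (-x ^ 2 / 2) * (Real.exp (x ^ 2 / 4)) ^ 2 = 1 := by
    rw [← Real.exp_nat_mul, ← Real.exp_add]; simp; ring
  have h3 : GHq m x * (Real.exp (-x ^ 2 / 2) * Hnorm (m + 1) x ^ 2) ≤ GHG m x := by
    have : 0 ≤ Real.exp (-x ^ 2 / 2) *
      (Real.sqrt ((m : ℝ) + 1) * Hnorm m x - x * Hnorm (m + 1) x / 2) ^ 2 := by positivity
    unfold GHG; linarith
  have h4 : GHq m x * (Real.exp (-x ^ 2 / 2) * Hnorm (m + 1) x ^ 2) ≤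
      GHq m x * (Real.exp (-x ^ 2 / 2) * (Real.exp (x ^ 2 / 4)) ^ 2) := by
    rw [e]; linarith
  have h5 := le_of_mul_le_mul_left (le_of_mul_le_mul_left h4 hq0) (Real.exp_pos _)
  exact abs_le_of_sq_le_sq h5 (Real.exp_pos _).le

lemma GH_lower (l : ℕ) (x : ℝ) (hx : Hnorm (l + 1) x = 0) :
    Real.exp (x ^ 2 / 4) ≤ ((l : ℝ) + 1) * Hnorm l x ^ 2 := by
  have hb := GH_root_bound l x hx
  have h := GHS_ge l x hb
  have g0 := GHG_zero_ge l
  have q0 : GHq l 0 = l + 3 / 2 := by simp [GHq]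
  have s1 : Real.sqrt ((l : ℝ) + 1) ^ 2 = l + 1 := Real.sq_sqrt (by positivity)
  have gx : GHG l x = Real.exp (-x ^ 2 / 2) * (((l : ℝ) + 1) * Hnorm l x ^ 2) := by
    simp [GHG, hx, mul_pow, s1]
  have qx : 0 < GHq l x := by unfold GHq; linarith
  rw [q0, div_le_div_iff₀ (by positivity) qx, gx] at h
  set t := x ^ 2 / 4 with ht
  have t0 : 0 ≤ t := by positivity
  have tl : t ≤ l := by linarith
  have e : Real.exp (-x ^ 2 / 2) * (Real.exp t * Real.exp t) = 1 := by
    rw [← Real.exp_add, ← Real.exp_add, ht]; simp; ring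
  have hexp : t + 1 ≤ Real.exp t := Real.add_one_le_exp t
  have qe : GHq l x = l + 3 / 2 - t := rfl
  have h1 : (l : ℝ) + 3 / 2 ≤ Real.exp t * GHq l x := by
    rw [qe] at *
    nlinarith
  have h2 : GHq l x ≤ Real.exp (-x ^ 2 / 2) * (((l : ℝ) + 1) * Hnorm l x ^ 2) * (l + 3 / 2) := by
    nlinarith
  set W := ((l : ℝ) + 1) * Hnorm l x ^ 2 with hW
  have W0 : 0 ≤ W := by positivity
  -- multiply by exp t * exp t
  have h3 : Real.exp t * Real.exp t * GHq l x ≤ W * (l + 3 / 2) := by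
    have := mul_le_mul_of_nonneg_left h2 (by positivity : 0 ≤ Real.exp t * Real.exp t)
    calc _ ≤ _ := this
      _ = (Real.exp (-x ^ 2 / 2) * (Real.exp t * Real.exp t)) * (W * (l + 3 / 2)) := by ring
      _ = _ := by rw [e, one_mul]
  have h4 : Real.exp t * (l + 3 / 2) ≤ W * (l + 3 / 2) := by
    have := mul_le_mul_of_nonneg_left h1 (Real.exp_pos t).le
    linarith
  exact le_of_mul_le_mul_right h4 (by positivity)

theorem gaussHermite_quad_hermite_lt_two (l : ℕ) (y : Fin (l + 1) → ℝ)
    (hy_inj : Function.Injective y)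
    (hy_root : ∀ k, Hnorm (l + 1) (y k) = 0)
    (w : Fin (l + 1) → ℝ)
    (hw : ∀ k, w k = 1 / (((l : ℝ) + 1) ^ 2 * (Hnorm l (y k)) ^ 2))
    (n : ℕ) :
    |∑ k, w k * Hnorm n (y k)| < 2 := by
  have hN : (0 : ℝ) < (l : ℝ) + 1 := by positivity
  have hw' : ∀ k, w k = 1 / ((l : ℝ) + 1) * (1 / (((l : ℝ) + 1) * Hnorm l (y k) ^ 2)) := by
    intro k
    rw [hw, one_div_mul_one_div]
    congr 1
    ring
  have hle : 1 / ((l : ℝ) + 1) ≤ 1 := by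
    rw [div_le_one hN]; linarith [(Nat.cast_nonneg l : (0 : ℝ) ≤ l)]
  rcases le_or_gt n (2 * l + 1) with hn | hn
  · have e : ∑ k, w k * Hnorm n (y k) = 1 / ((l : ℝ) + 1) *
        ∑ k, 1 / (((l : ℝ) + 1) * Hnorm l (y k) ^ 2) * (Hnorm 0 (y k) * Hnorm n (y k)) := by
      rw [Finset.mul_sum]
      refine Finset.sum_congr rfl fun k _ => ?_
      rw [hw', GH_zero]; ring
    rw [e]
    rcases Nat.eq_zero_or_pos n with rfl | hp
    · have := GH_orth l y hy_inj hy_root 0 0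
      simp only [Fin.val_zero, if_true] at this
      rw [this, mul_one, abs_of_pos (by positivity)]
      linarith
    · rw [GH_exact l y hy_inj hy_root n 0 hp (by omega)]; simp
  · have hk : ∀ k ∈ Finset.univ, |w k * Hnorm n (y k)| ≤ 1 / ((l : ℝ) + 1) := by
      intro k _
      have h1 := GH_lower l (y k) (hy_root k)
      have h2 := GH_upper l n (by omega) (y k) (GH_root_bound l _ (hy_root k))
      have p := GH_pos_root l (y k) (hy_root k)
      rw [abs_mul, hw', abs_of_pos (by positivity), mul_assoc]
      refine mul_le_of_le_one_right (by positivity) ?_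
      rw [one_div_mul_eq_div, div_le_one p]
      exact h2.trans h1
    refine lt_of_le_of_lt ((Finset.abs_sum_le_sum_abs _ _).trans (Finset.sum_le_sum hk)) ?_
    rw [Finset.sum_const, Finset.card_univ, Fintype.card_fin, nsmul_eq_mul]
    push_cast
    rw [mul_one_div_cancel hN.ne']
    norm_num
end

section
/- Assume Assumptions A.1 and A.2 hold for the given univariate quadrature family. Then for every downward closed set Λ ⊆ F and every ν ∈ F with ν ≠ 0, the sparse quadrature of the multivariate Hermite polynomial H_ν over Λ ∩ R_ν satisfies |Q_{Λ∩R_ν}(H_ν)| ≤ ∏_{j∈supp ν} (1+ν_j)³. -/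
open MeasureTheory ProbabilityTheory

variable {E : Type*} [NormedAddCommGroup E] [NormedSpace ℝ E]

theorem aux_df_mono : ∀ k : ℕ, Nat.doubleFactorial k ≤ Nat.doubleFactorial (k + 1)
  | 0 => by simp [Nat.doubleFactorial]
  | 1 => by simp [Nat.doubleFactorial]
  | k + 2 => by
    have h := aux_df_mono k
    rw [Nat.doubleFactorial_add_two, show k + 2 + 1 = (k + 1) + 2 from rfl,
      Nat.doubleFactorial_add_two]
    exact Nat.mul_le_mul (by omega) h

theorem aux_Hnorm_zero (n : ℕ) : |Hnorm n 0| ≤ 1 := by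
  have h0 : (Polynomial.aeval (0 : ℝ) (Polynomial.hermite n)) =
      (((Polynomial.hermite n).coeff 0 : ℤ) : ℝ) := by
    rw [← Polynomial.coeff_zero_eq_aeval_zero']
    simp
  unfold Hnorm
  rw [h0, abs_div, abs_of_nonneg (Real.sqrt_nonneg _), div_le_one (by positivity)]
  apply Real.le_sqrt_of_sq_le
  rw [sq_abs, Polynomial.coeff_hermite]
  split_ifs with he
  · rcases n with _ | n
    · simp
    · have h1 : Nat.doubleFactorial n ^ 2 ≤ Nat.factorial (n + 1) := by
        rw [Nat.factorial_eq_mul_doubleFactorial, sq]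
        exact Nat.mul_le_mul_right _ (aux_df_mono n)
      push_cast
      simp only [Nat.sub_zero, Nat.add_sub_cancel, Nat.choose_zero_right, Nat.cast_one, mul_one,
        mul_pow, ← pow_mul]
      rw [mul_comm ((n + 1) / 2) 2, pow_mul]
      norm_num
      exact_mod_cast h1
  · simp

theorem aux_tensor (Q : QuadFamily) (ν : ℕ →₀ ℕ) (s : Finset ℕ) (hs : s ⊆ ν.support)
    (lev : ℕ → ℕ) :
    Q.tensor s lev (Hmulti ν) = (∏ j ∈ s, Q.quad (lev j) (Hnorm (ν j))) *
      ∏ j ∈ ν.support \ s, Hnorm (ν j) 0 := by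
  unfold QuadFamily.tensor QuadFamily.quad
  rw [Finset.prod_sum, Finset.sum_mul]
  apply Finset.sum_congr rfl
  intro k _
  simp only [smul_eq_mul]
  rw [Finset.prod_mul_distrib, mul_assoc]
  congr 1
  unfold Hmulti
  rw [← Finset.prod_sdiff hs, mul_comm]
  congr 1
  · rw [← Finset.prod_attach s]
    apply Finset.prod_congr rfl
    intro j _
    simp
  · apply Finset.prod_congr rfl
    intro j hj
    simp [(Finset.mem_sdiff.1 hj).2]

theorem aux_tensor_bound (Q : QuadFamily) (hA2 : Q.BoundedA2) (ν : ℕ →₀ ℕ) (s : Finset ℕ)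
    (hs : s ⊆ ν.support) (lev : ℕ → ℕ) :
    |Q.tensor s lev (Hmulti ν)| ≤ 2 ^ s.card := by
  rw [aux_tensor Q ν s hs, abs_mul, Finset.abs_prod, Finset.abs_prod]
  have h1 : ∏ j ∈ s, |Q.quad (lev j) (Hnorm (ν j))| ≤ 2 ^ s.card := by
    rw [← Finset.prod_const]
    exact Finset.prod_le_prod (fun _ _ => abs_nonneg _) (fun j _ => (hA2 _ _).le)
  have h2 : ∏ j ∈ ν.support \ s, |Hnorm (ν j) 0| ≤ 1 :=
    Finset.prod_le_one (fun _ _ => abs_nonneg _) (fun j _ => aux_Hnorm_zero _)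
  calc _ ≤ (2 : ℝ) ^ s.card * 1 :=
        mul_le_mul h1 h2 (Finset.prod_nonneg fun _ _ => abs_nonneg _) (by positivity)
    _ = _ := mul_one _

theorem aux_delta_bound (Q : QuadFamily) (hA2 : Q.BoundedA2) (ν μ : ℕ →₀ ℕ)
    (hs : μ.support ⊆ ν.support) :
    |Q.delta μ (Hmulti ν)| ≤ ∏ j ∈ ν.support, (if μ j = 0 then (1 : ℝ) else 4) := by
  have h1 : |Q.delta μ (Hmulti ν)| ≤ ∑ T ∈ μ.support.powerset, (2 : ℝ) ^ μ.support.card := by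
    unfold QuadFamily.delta
    refine (Finset.abs_sum_le_sum_abs _ _).trans (Finset.sum_le_sum fun T _ => ?_)
    rw [smul_eq_mul, abs_mul, abs_pow, abs_neg, abs_one, one_pow, one_mul]
    exact aux_tensor_bound Q hA2 ν _ hs _
  refine h1.trans (le_of_eq ?_)
  rw [Finset.sum_const, Finset.card_powerset, nsmul_eq_mul]
  push_cast
  rw [← mul_pow, ← Finset.prod_sdiff hs, Finset.prod_eq_one, one_mul, ← Finset.prod_const]
  · apply Finset.prod_congr rfl
    intro j hj
    rw [if_neg (Finsupp.mem_support_iff.1 hj)]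
    norm_num
  · intro j hj
    rw [if_pos (Finsupp.notMem_support_iff.1 (Finset.mem_sdiff.1 hj).2)]

/-- Bound on the sparse quadrature of the multivariate Hermite polynomial `H_ν`
over `Λ ∩ R_ν`: `|Q_{Λ∩R_ν}(H_ν)| ≤ ∏_{j∈supp ν} (1+ν_j)³`. -/
theorem sparse_quadrature_hermite_bound
    (Q : QuadFamily) (hA1 : Q.ExactA1) (hA2 : Q.BoundedA2)
    (Λ : Set (ℕ →₀ ℕ)) (hΛ : DownwardClosed Λ)
    (ν : ℕ →₀ ℕ) (hν : ν ≠ 0)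
    (Λν : Finset (ℕ →₀ ℕ)) (hΛν : (↑Λν : Set (ℕ →₀ ℕ)) = Λ ∩ {μ | μ ≤ ν}) :
    |Q.sparse Λν (Hmulti ν)| ≤ ∏ j ∈ ν.support, ((1 : ℝ) + ν j) ^ 3 := by
  have hle : ∀ μ ∈ Λν, μ ≤ ν := by
    intro μ hμ
    have : μ ∈ (↑Λν : Set (ℕ →₀ ℕ)) := hμ
    rw [hΛν] at this
    exact this.2
  have hsupp : ∀ μ ∈ Λν, μ.support ⊆ ν.support := fun μ hμ => Finsupp.support_mono (hle μ hμ)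
  let e : (ℕ →₀ ℕ) → (∀ j ∈ ν.support, ℕ) := fun μ j _ => μ j
  have he : Set.InjOn e (Λν : Set (ℕ →₀ ℕ)) := by
    intro a ha b hb hab
    ext j
    by_cases hj : j ∈ ν.support
    · exact congrFun (congrFun hab j) hj
    · rw [Finsupp.notMem_support_iff.1 fun h => hj (hsupp a ha h),
        Finsupp.notMem_support_iff.1 fun h => hj (hsupp b hb h)]
  calc |Q.sparse Λν (Hmulti ν)| ≤ ∑ μ ∈ Λν, |Q.delta μ (Hmulti ν)| :=
        Finset.abs_sum_le_sum_abs _ _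
    _ ≤ ∑ μ ∈ Λν, ∏ j ∈ ν.support, (if μ j = 0 then (1 : ℝ) else 4) :=
        Finset.sum_le_sum fun μ hμ => aux_delta_bound Q hA2 ν μ (hsupp μ hμ)
    _ = ∑ p ∈ Λν.image e, ∏ x ∈ ν.support.attach, (if p x.1 x.2 = 0 then (1 : ℝ) else 4) := by
        rw [Finset.sum_image he]
        refine Finset.sum_congr rfl fun μ _ => ?_
        rw [← Finset.prod_attach]
    _ ≤ ∑ p ∈ ν.support.pi (fun j => Finset.range (ν j + 1)),
          ∏ x ∈ ν.support.attach, (if p x.1 x.2 = 0 then (1 : ℝ) else 4) := by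
        apply Finset.sum_le_sum_of_subset_of_nonneg
        · intro p hp
          obtain ⟨μ, hμ, rfl⟩ := Finset.mem_image.1 hp
          rw [Finset.mem_pi]
          intro j _
          exact Finset.mem_range.2 (Nat.lt_succ_of_le (hle μ hμ j))
        · intro p _ _
          exact Finset.prod_nonneg fun x _ => by split_ifs <;> norm_num
    _ = ∏ j ∈ ν.support, ∑ l ∈ Finset.range (ν j + 1), (if l = 0 then (1 : ℝ) else 4) := by
        rw [Finset.prod_sum]
    _ ≤ _ := by
        apply Finset.prod_le_prod
        · intro j _
          exact Finset.sum_nonneg fun x _ => by split_ifs <;> norm_num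
        · intro j hj
          have h1 : (1 : ℝ) ≤ ν j := by
            exact_mod_cast Nat.one_le_iff_ne_zero.2 (Finsupp.mem_support_iff.1 hj)
          rw [Finset.sum_range_succ']
          simp only [Nat.add_eq_zero_iff, one_ne_zero, and_false, if_false, if_true,
            Finset.sum_const, Finset.card_range, nsmul_eq_mul]
          nlinarith [mul_nonneg (sub_nonneg.2 h1) (sub_nonneg.2 h1),
            mul_nonneg (mul_nonneg (sub_nonneg.2 h1) (sub_nonneg.2 h1)) (sub_nonneg.2 h1)]
end

section
/- For every finitely supported multi-index ν ∈ F with ν ≠ 0, the sum over all multi-indices μ ⪯ ν of 4 raised to the size of the support of μ satisfies Σ_{μ⪯ν} 4^{|supp μ|} ≤ ∏_{j∈supp ν} 4(1+ν_j) ≤ ∏_{j∈supp ν} (1+ν_j)³. -/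
open MeasureTheory ProbabilityTheory

variable {E : Type*} [NormedAddCommGroup E] [NormedSpace ℝ E]

/-- Counting bound: `Σ_{μ⪯ν} 4^{|supp μ|} ≤ ∏_{j∈supp ν} 4(1+ν_j) ≤ ∏_{j∈supp ν} (1+ν_j)³`. -/
theorem sum_pow_four_support_le (ν : ℕ →₀ ℕ) (hν : ν ≠ 0) :
    (∑ μ ∈ Finset.Iic ν, 4 ^ μ.support.card ≤ ∏ j ∈ ν.support, 4 * (1 + ν j)) ∧
    (∏ j ∈ ν.support, 4 * (1 + ν j)) ≤ ∏ j ∈ ν.support, (1 + ν j) ^ 3 := by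
  constructor
  · have h1 : ∑ μ ∈ Finset.Iic ν, 4 ^ μ.support.card ≤
        ∑ _μ ∈ Finset.Iic ν, 4 ^ ν.support.card := by
      refine Finset.sum_le_sum fun μ hμ => ?_
      exact Nat.pow_le_pow_right (by norm_num)
        (Finset.card_le_card (Finsupp.support_mono (Finset.mem_Iic.1 hμ)))
    refine h1.trans (le_of_eq ?_)
    rw [Finset.sum_const, Finsupp.card_Iic, Finset.prod_mul_distrib, Finset.prod_const,
      smul_eq_mul, mul_comm]
    congr 1
    refine Finset.prod_congr rfl fun j _ => ?_
    rw [Nat.card_Iic, add_comm]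
  · refine Finset.prod_le_prod' fun j hj => ?_
    have h : 1 ≤ ν j := Nat.one_le_iff_ne_zero.2 (Finsupp.mem_support_iff.1 hj)
    have h2 : 2 ^ 2 ≤ (1 + ν j) ^ 2 := Nat.pow_le_pow_left (by omega) 2
    rw [pow_succ (1 + ν j) 2]
    exact Nat.mul_le_mul_right _ h2
end

section
/- Let 0 < q < 2, let (τ_j)_{j≥1} be positive reals with Σ_{j≥1} τ_j^{−q} < ∞, and let r be a positive integer with r > 2/q. Then the weights b_ν = ∏_{j≥1} Σ_{l=0}^{r} binom(ν_j, l) τ_j^{2l} satisfy Σ_{ν∈F} b_ν^{−q/2} < ∞. -/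
open MeasureTheory ProbabilityTheory

variable {E : Type*} [NormedAddCommGroup E] [NormedSpace ℝ E]

theorem aux_key (k n : ℕ) (hn : 1 ≤ n) (c t : ℝ) (hc : 0 < c) (hc1 : c ≤ 1) (hct : c ≤ t) :
    c ^ (2 * k) / (((k + 1 : ℕ) : ℝ) ^ (k + 1) * (Nat.factorial (k + 1) : ℝ)) * (n : ℝ) ^ (k + 1) * t ^ 2
      ≤ ∑ l ∈ Finset.range (k + 1 + 1), (n.choose l : ℝ) * t ^ (2 * l) := by
  have ht : 0 < t := lt_of_lt_of_le hc hct
  have hterm : ∀ l ∈ Finset.range (k + 1 + 1), 0 ≤ (n.choose l : ℝ) * t ^ (2 * l) :=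
    fun l _ => by positivity
  have hr1 : (1 : ℝ) ≤ (Nat.factorial (k + 1) : ℝ) := by
    exact_mod_cast Nat.factorial_pos (k + 1)
  have hck : c ^ (2 * k) ≤ 1 := pow_le_one₀ hc.le hc1
  have hn1 : (1 : ℝ) ≤ n := by exact_mod_cast hn
  have hrr : (0 : ℝ) < ((k + 1 : ℕ) : ℝ) ^ (k + 1) := by positivity
  rcases lt_or_ge n (k + 1) with h | h
  · refine le_trans ?_ (Finset.single_le_sum hterm (Finset.mem_range.2 (by omega : 1 < k + 1 + 1)))
    have h1 : (n : ℝ) ^ (k + 1) ≤ ((k + 1 : ℕ) : ℝ) ^ (k + 1) := by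
      gcongr
    have h2 : c ^ (2 * k) / (((k + 1 : ℕ) : ℝ) ^ (k + 1) * (Nat.factorial (k + 1) : ℝ))
        * (n : ℝ) ^ (k + 1) ≤ 1 := by
      rw [div_mul_eq_mul_div, div_le_one (by positivity)]
      calc c ^ (2 * k) * (n : ℝ) ^ (k + 1) ≤ 1 * ((k + 1 : ℕ) : ℝ) ^ (k + 1) := by gcongr
        _ ≤ ((k + 1 : ℕ) : ℝ) ^ (k + 1) * (Nat.factorial (k + 1) : ℝ) := by nlinarith
    simp only [Nat.choose_one_right, mul_one]
    gcongr
    exact h2.trans hn1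
  · refine le_trans ?_ (Finset.single_le_sum hterm (Finset.mem_range.2 (by omega : k + 1 < k + 1 + 1)))
    have h0 := Nat.pow_le_choose (α := ℝ) (k + 1) n
    have h1 : (n : ℝ) ≤ ((k + 1 : ℕ) : ℝ) * ((n + 1 - (k + 1) : ℕ) : ℝ) := by
      obtain ⟨m, rfl⟩ := Nat.exists_eq_add_of_le h
      have : k + 1 + m + 1 - (k + 1) = m + 1 := by omega
      rw [this]
      push_cast
      have : (0 : ℝ) ≤ k * m := by positivity
      nlinarith
    have h2 : (n : ℝ) ^ (k + 1) ≤
        ((k + 1 : ℕ) : ℝ) ^ (k + 1) * ((n + 1 - (k + 1) : ℕ) : ℝ) ^ (k + 1) := by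
      rw [← mul_pow]
      gcongr
    have h3 : (n : ℝ) ^ (k + 1) / (((k + 1 : ℕ) : ℝ) ^ (k + 1) * (Nat.factorial (k + 1) : ℝ))
        ≤ n.choose (k + 1) := by
      refine le_trans ?_ h0
      rw [← div_div]
      gcongr
      rw [div_le_iff₀ hrr]
      linarith
    have h4 : c ^ (2 * k) ≤ t ^ (2 * k) := by gcongr
    calc _ = (n : ℝ) ^ (k + 1) / (((k + 1 : ℕ) : ℝ) ^ (k + 1) * (Nat.factorial (k + 1) : ℝ))
          * (c ^ (2 * k) * t ^ 2) := by ring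
      _ ≤ n.choose (k + 1) * (t ^ (2 * k) * t ^ 2) := by gcongr
      _ = _ := by ring

theorem aux_finsupp (h : ℕ → ℕ → ℝ) (hnn : ∀ j n, 0 ≤ h j n) (h0 : ∀ j, h j 0 = 1)
    (w a : ℕ → ℝ) (hw : Summable w) (ha : Summable a) (hwn : ∀ n, 0 ≤ w n) (han : ∀ j, 0 ≤ a j)
    (hle : ∀ j n, 1 ≤ n → h j n ≤ w n * a j) :
    Summable fun ν : ℕ →₀ ℕ => ∏ j ∈ ν.support, h j (ν j) := by
  classical
  refine summable_of_sum_le (c := Real.exp ((∑' n, w n) * ∑' j, a j))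
    (fun ν => Finset.prod_nonneg fun j _ => hnn _ _) fun u => ?_
  set S : Finset ℕ := u.sup Finsupp.support with hS
  set N : ℕ := u.sup (fun ν => S.sup ν) with hN
  have hsub : u ⊆ S.finsupp (fun _ => Finset.range (N + 1)) := by
    intro ν hν
    rw [Finset.mem_finsupp_iff]
    refine ⟨Finset.le_sup (f := Finsupp.support) hν, fun i hi => ?_⟩
    have h1 : ν i ≤ S.sup ν := Finset.le_sup hi
    have h2 : S.sup ν ≤ N := Finset.le_sup (f := fun ν : ℕ →₀ ℕ => S.sup ν) hν
    exact Finset.mem_range.2 (by omega)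
  have hW : 0 ≤ ∑' n, w n := tsum_nonneg hwn
  calc ∑ ν ∈ u, ∏ j ∈ ν.support, h j (ν j)
      ≤ ∑ ν ∈ S.finsupp (fun _ => Finset.range (N + 1)), ∏ j ∈ ν.support, h j (ν j) :=
        Finset.sum_le_sum_of_subset_of_nonneg hsub
          fun ν _ _ => Finset.prod_nonneg fun j _ => hnn _ _
    _ = ∑ ν ∈ S.finsupp (fun _ => Finset.range (N + 1)), ∏ j ∈ S, h j (ν j) := by
        refine Finset.sum_congr rfl fun ν hν => ?_
        refine Finset.prod_subset (Finset.mem_finsupp_iff.1 hν).1 fun j _ hj => ?_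
        rw [Finsupp.notMem_support_iff.1 hj, h0]
    _ = ∏ j ∈ S, ∑ n ∈ Finset.range (N + 1), h j n := by
        rw [Finset.prod_sum, Finset.finsupp, Finset.sum_map]
        refine Finset.sum_congr (by congr!) fun p _ => ?_
        rw [← Finset.prod_attach]
        refine Finset.prod_congr rfl fun x _ => ?_
        simp [Finsupp.indicator_of_mem x.2]
    _ ≤ ∏ j ∈ S, (1 + (∑' n, w n) * a j) := by
        refine Finset.prod_le_prod (fun j _ => Finset.sum_nonneg fun n _ => hnn _ _) fun j _ => ?_
        rw [Finset.sum_range_succ', h0, add_comm]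
        gcongr
        calc ∑ n ∈ Finset.range N, h j (n + 1) ≤ ∑ n ∈ Finset.range N, w (n + 1) * a j :=
              Finset.sum_le_sum fun n _ => hle j (n + 1) (by omega)
          _ = (∑ n ∈ Finset.range N, w (n + 1)) * a j := by rw [Finset.sum_mul]
          _ ≤ (∑' n, w n) * a j := by
              refine mul_le_mul_of_nonneg_right ?_ (han j)
              have := hw.sum_le_tsum (Finset.range (N + 1)) fun n _ => hwn n
              rw [Finset.sum_range_succ'] at this
              linarith [hwn 0]
    _ ≤ Real.exp (∑ j ∈ S, (∑' n, w n) * a j) :=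
        Real.prod_one_add_le_exp_sum _ fun j => mul_nonneg hW (han j)
    _ ≤ _ := by
        rw [← Finset.mul_sum]
        gcongr
        exact ha.sum_le_tsum _ fun j _ => han j

/-- Summability of `b_ν^{-q/2}` over all finitely supported multi-indices. -/
theorem summable_bwt_neg_q_half (q : ℝ) (hq0 : 0 < q) (hq2 : q < 2)
    (τ : ℕ → ℝ) (hτ : ∀ j, 0 < τ j)
    (hτq : Summable fun j : ℕ => τ j ^ (-q))
    (r : ℕ) (hr : 0 < r) (hrq : 2 / q < (r : ℝ)) :
    Summable fun ν : ℕ →₀ ℕ => bwt r τ ν ^ (-(q / 2)) := by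
  obtain ⟨k, rfl⟩ : ∃ k, r = k + 1 := ⟨r - 1, by omega⟩
  have hpos : ∀ j, 0 < τ j ^ (-q) := fun j => Real.rpow_pos_of_pos (hτ j) _
  obtain ⟨c, hc, hc1, hct⟩ : ∃ c : ℝ, 0 < c ∧ c ≤ 1 ∧ ∀ j, c ≤ τ j := by
    have hS : ∀ j, τ j ^ (-q) ≤ ∑' j, τ j ^ (-q) := fun j =>
      hτq.le_tsum j fun i _ => (hpos i).le
    have hS0 : 0 < ∑' j, τ j ^ (-q) := lt_of_lt_of_le (hpos 0) (hS 0)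
    refine ⟨min 1 ((∑' j, τ j ^ (-q)) ^ (-q)⁻¹), lt_min one_pos (Real.rpow_pos_of_pos hS0 _),
      min_le_left _ _, fun j => (min_le_right _ _).trans ?_⟩
    have := Real.rpow_le_rpow_of_nonpos (hpos j) (hS j)
      (inv_nonpos.2 (by linarith : -q ≤ 0))
    rwa [Real.rpow_rpow_inv (hτ j).le (by linarith)] at this
  set K : ℝ := c ^ (2 * k) / (((k + 1 : ℕ) : ℝ) ^ (k + 1) * (Nat.factorial (k + 1) : ℝ)) with hK
  have hK0 : 0 < K := by positivity
  have hβnn : ∀ j n : ℕ, 0 ≤ ∑ l ∈ Finset.range (k + 1 + 1), (n.choose l : ℝ) * τ j ^ (2 * l) :=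
    fun j n => Finset.sum_nonneg fun l _ => by have := hτ j; positivity
  have hmain := aux_finsupp
    (fun j n => (∑ l ∈ Finset.range (k + 1 + 1), (n.choose l : ℝ) * τ j ^ (2 * l)) ^ (-(q / 2)))
    (fun j n => Real.rpow_nonneg (hβnn j n) _)
    (fun j => by simp [Finset.sum_range_succ'])
    (fun n => K ^ (-(q / 2)) * (n : ℝ) ^ (((k + 1 : ℕ) : ℝ) * (-(q / 2))))
    (fun j => τ j ^ (-q))
    (by
      refine Summable.mul_left _ (Real.summable_nat_rpow.2 ?_)
      rw [div_lt_iff₀ hq0] at hrq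
      linarith) hτq (fun n => by positivity) (fun j => (hpos j).le)
    (by
      intro j n hn
      have hn0 : (0 : ℝ) < n := by exact_mod_cast hn
      have ht := hτ j
      refine (Real.rpow_le_rpow_of_nonpos (by positivity)
        (aux_key k n hn c (τ j) hc hc1 (hct j)) (by linarith)).trans ?_
      rw [← hK, Real.mul_rpow (by positivity) (by positivity),
        Real.mul_rpow (by positivity) (by positivity), Real.rpow_mul hn0.le, Real.rpow_natCast,
        ← Real.rpow_natCast (τ j) 2, ← Real.rpow_mul ht.le]
      refine le_of_eq ?_
      congr 2
      push_cast
      ring)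
  refine hmain.congr fun ν => ?_
  rw [bwt, Real.finset_prod_rpow _ _ fun j _ => hβnn j (ν j)]
end

section
/- Let 0 < q < 2, let (τ_j)_{j≥1} be positive reals with Σ_{j≥1} τ_j^{−q} < ∞, let r be a positive integer with r > 14/q, and let η ≥ q/4. Then Σ_{ν∈F} (b_ν / c_ν^{1/η})^{−2η} < ∞, i.e. Σ_{ν∈F} c_ν² · b_ν^{−2η} < ∞, where b_ν = ∏_{j≥1} Σ_{l=0}^{r} binom(ν_j, l) τ_j^{2l} and c_ν = ∏_{j∈supp ν} (1+ν_j)³. -/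
open MeasureTheory ProbabilityTheory

variable {E : Type*} [NormedAddCommGroup E] [NormedSpace ℝ E]

lemma aux_prod_summable (f : ℕ → ℕ → ℝ) (g s : ℕ → ℝ) (hf : ∀ j n, 0 ≤ f j n)
    (hg0 : ∀ n, 0 ≤ g n) (hs0 : ∀ j, 0 ≤ s j) (hg : Summable g) (hs : Summable s)
    (hfg : ∀ j n, n ≠ 0 → f j n ≤ g n * s j) :
    Summable fun ν : ℕ →₀ ℕ => ∏ j ∈ ν.support, f j (ν j) := by
  classical
  refine summable_of_sum_le (c := Real.exp ((∑' n, g n) * ∑' j, s j))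
    (fun ν => Finset.prod_nonneg fun j _ => hf _ _) ?_
  intro u
  set F : ℕ → ℕ → ℝ := fun j n => if n = 0 then 1 else f j n with hF
  have hF0 : ∀ j n, 0 ≤ F j n := by
    intro j n
    simp only [hF]
    split_ifs
    · exact zero_le_one
    · exact hf _ _
  set J : Finset ℕ := u.biUnion (fun ν => ν.support) with hJ
  set N : Finset ℕ := insert 0 (u.biUnion (fun ν => ν.support.image ν)) with hN
  have hsub : u ⊆ J.finsupp (fun _ => N) := by
    intro ν hν
    rw [Finset.mem_finsupp_iff]
    refine ⟨Finset.subset_biUnion_of_mem (fun ν : ℕ →₀ ℕ => ν.support) hν, ?_⟩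
    intro j _
    by_cases h : ν j = 0
    · simp [hN, h]
    · refine Finset.mem_insert_of_mem (Finset.mem_biUnion.2 ⟨ν, hν, ?_⟩)
      exact Finset.mem_image_of_mem _ (by simpa using h)
  have hw : ∀ ν ∈ J.finsupp (fun _ => N),
      ∏ j ∈ ν.support, f j (ν j) = ∏ j ∈ J, F j (ν j) := by
    intro ν hν
    rw [Finset.mem_finsupp_iff] at hν
    rw [← Finset.prod_subset hν.1]
    · refine Finset.prod_congr rfl fun j hj => ?_
      simp [hF, Finsupp.mem_support_iff.1 hj]
    · intro j _ hj
      simp [hF, Finsupp.notMem_support_iff.1 hj]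
  calc ∑ ν ∈ u, ∏ j ∈ ν.support, f j (ν j)
      ≤ ∑ ν ∈ J.finsupp (fun _ => N), ∏ j ∈ ν.support, f j (ν j) :=
        Finset.sum_le_sum_of_subset_of_nonneg hsub
          fun ν _ _ => Finset.prod_nonneg fun j _ => hf _ _
    _ = ∑ ν ∈ J.finsupp (fun _ => N), ∏ j ∈ J, F j (ν j) := Finset.sum_congr rfl hw
    _ = ∏ j ∈ J, ∑ n ∈ N, F j n := by
        rw [Finset.prod_sum, Finset.finsupp, Finset.sum_map]
        refine Finset.sum_congr (by congr!) fun p _ => ?_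
        rw [← Finset.prod_attach]
        refine Finset.prod_congr rfl fun j _ => ?_
        simp [Finsupp.indicator_of_mem]
    _ ≤ ∏ j ∈ J, Real.exp ((∑' n, g n) * s j) := by
        refine Finset.prod_le_prod (fun j _ => Finset.sum_nonneg fun n _ => hF0 _ _) ?_
        intro j _
        have h1 : ∑ n ∈ N, F j n ≤ 1 + (∑' n, g n) * s j := by
          have h0 : (0:ℕ) ∈ N := by simp [hN]
          rw [← Finset.add_sum_erase _ _ h0]
          have : ∑ n ∈ N.erase 0, F j n ≤ ∑ n ∈ N.erase 0, g n * s j := by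
            refine Finset.sum_le_sum fun n hn => ?_
            have hn0 := Finset.ne_of_mem_erase hn
            simp only [hF, hn0, if_false]
            exact hfg j n hn0
          rw [← Finset.sum_mul] at this
          have h2 : ∑ n ∈ N.erase 0, g n ≤ ∑' n, g n :=
            hg.sum_le_tsum _ fun n _ => hg0 n
          have h3 := mul_le_mul_of_nonneg_right h2 (hs0 j)
          have h4 : F j 0 = 1 := by simp [hF]
          linarith
        have := Real.add_one_le_exp ((∑' n, g n) * s j)
        linarith
    _ = Real.exp ((∑' n, g n) * ∑ j ∈ J, s j) := by
        rw [← Real.exp_sum, Finset.mul_sum]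
    _ ≤ _ := by
        refine Real.exp_le_exp.2 (mul_le_mul_of_nonneg_left ?_ (tsum_nonneg hg0))
        exact hs.sum_le_tsum _ fun j _ => hs0 j

lemma aux_choose (r n : ℕ) :
    ((n:ℝ) + 1) ^ r ≤ ((r:ℝ) + 1) ^ r * (r.factorial : ℝ) * (n.choose (min n r) : ℝ) := by
  rcases le_total r n with h | h
  · rw [min_eq_right h]
    have h1 := Nat.pow_le_choose (α := ℝ) r n
    have h1' : ((n:ℝ) + 1 - r) ^ r ≤ (r.factorial : ℝ) * (n.choose r : ℝ) := by
      rw [Nat.cast_sub (by omega)] at h1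
      push_cast at h1
      first
        | exact h1
        | (rw [div_le_iff₀ (by positivity)] at h1; linarith)
    have hrn : (r:ℝ) ≤ n := by exact_mod_cast h
    have h2 : ((n:ℝ) + 1) ≤ ((r:ℝ) + 1) * ((n:ℝ) + 1 - r) := by
      nlinarith [mul_nonneg (Nat.cast_nonneg (α := ℝ) r) (sub_nonneg.2 hrn)]
    calc ((n:ℝ) + 1) ^ r ≤ (((r:ℝ) + 1) * ((n:ℝ) + 1 - r)) ^ r := by gcongr
      _ = ((r:ℝ) + 1) ^ r * ((n:ℝ) + 1 - r) ^ r := mul_pow _ _ _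
      _ ≤ ((r:ℝ) + 1) ^ r * ((r.factorial : ℝ) * (n.choose r : ℝ)) := by gcongr
      _ = _ := by ring
  · rw [min_eq_left h, Nat.choose_self]
    have hrn : (n:ℝ) ≤ r := by exact_mod_cast h
    have h1 : (1:ℝ) ≤ r.factorial := by exact_mod_cast Nat.one_le_iff_ne_zero.2 r.factorial_ne_zero
    calc ((n:ℝ) + 1) ^ r ≤ ((r:ℝ) + 1) ^ r := by gcongr
      _ ≤ ((r:ℝ) + 1) ^ r * (r.factorial : ℝ) := le_mul_of_one_le_right (by positivity) h1
      _ = _ := by simp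

/-- Summability of `(b_ν / c_ν^{1/η})^{-2η} = c_ν² b_ν^{-2η}` over all finitely
supported multi-indices. -/
theorem summable_cwt_sq_mul_bwt_neg (q : ℝ) (hq0 : 0 < q) (hq2 : q < 2)
    (τ : ℕ → ℝ) (hτ : ∀ j, 0 < τ j)
    (hτq : Summable fun j : ℕ => τ j ^ (-q))
    (r : ℕ) (hr : 0 < r) (hrq : 14 / q < (r : ℝ))
    (η : ℝ) (hη : q / 4 ≤ η) :
    Summable fun ν : ℕ →₀ ℕ => cwt ν ^ 2 * bwt r τ ν ^ (-(2 * η)) := by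
  set β : ℕ → ℕ → ℝ := fun j n =>
    ∑ l ∈ Finset.range (r + 1), (n.choose l : ℝ) * τ j ^ (2 * l) with hβ
  have hterm : ∀ j n l, 0 ≤ ((n:ℕ).choose l : ℝ) * τ j ^ (2 * l) := fun j n l => by
    have := hτ j
    positivity
  have hβ1 : ∀ j n, 1 ≤ β j n := by
    intro j n
    have := Finset.single_le_sum (f := fun l => (n.choose l : ℝ) * τ j ^ (2 * l))
      (s := Finset.range (r + 1)) (fun l _ => hterm j n l) (Finset.mem_range.2 (Nat.succ_pos r))
    simpa using this
  have hβm : ∀ j n, (n.choose (min n r) : ℝ) * τ j ^ (2 * min n r) ≤ β j n := by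
    intro j n
    exact Finset.single_le_sum (f := fun l => (n.choose l : ℝ) * τ j ^ (2 * l))
      (s := Finset.range (r + 1)) (fun l _ => hterm j n l)
      (Finset.mem_range.2 (by have := min_le_right n r; omega))
  set M : ℝ := max 1 (∑' j, τ j ^ (-q)) with hM
  have hx0 : ∀ j, 0 < τ j ^ (-q) := fun j => Real.rpow_pos_of_pos (hτ j) _
  have hxM : ∀ j, τ j ^ (-q) ≤ M := fun j =>
    (hτq.le_tsum j fun i _ => (hx0 i).le).trans (le_max_right _ _)
  have hM1 : 1 ≤ M := le_max_left _ _
  set D : ℝ := ((r:ℝ) + 1) ^ r * (r.factorial : ℝ) with hD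
  have hD0 : 0 < D := by positivity
  have key := aux_prod_summable
    (fun j n => (((1:ℝ) + n) ^ 3) ^ 2 * β j n ^ (-(2 * η)))
    (fun n => D ^ (q / 2) * M ^ r * ((n:ℝ) + 1) ^ (6 - r * q / 2))
    (fun j => τ j ^ (-q))
    (fun j n => mul_nonneg (by positivity)
      (Real.rpow_nonneg (zero_le_one.trans (hβ1 j n)) _))
    (fun n => by positivity) (fun j => (hx0 j).le) ?_ hτq ?_
  · refine key.congr fun ν => ?_
    rw [Finset.prod_mul_distrib, Finset.prod_pow, cwt, bwt,
      ← Real.finsetProd_rpow _ _ (fun j _ => zero_le_one.trans (hβ1 j (ν j)))]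
  · refine Summable.mul_left _ ?_
    have h1 : (6 - r * q / 2 : ℝ) < -1 := by
      rw [div_lt_iff₀ hq0] at hrq
      linarith
    have := (summable_nat_add_iff 1).2 (Real.summable_nat_rpow.2 h1)
    simpa using this
  · intro j n hn
    have hn1 : (0:ℝ) < (n:ℝ) + 1 := by positivity
    set m := min n r with hm
    have hm1 : 1 ≤ m := by simp only [hm]; omega
    have hmr : m ≤ r := min_le_right _ _
    have ht := hτ j
    have hB : D⁻¹ * ((n:ℝ) + 1) ^ r * τ j ^ (2 * m) ≤ β j n := by
      refine le_trans ?_ (hβm j n)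
      refine mul_le_mul_of_nonneg_right ?_ (by positivity)
      rw [inv_mul_le_iff₀ hD0]
      exact aux_choose r n
    have h1 : β j n ^ (-(2 * η)) ≤ β j n ^ (-(q / 2)) :=
      Real.rpow_le_rpow_of_exponent_le (hβ1 j n) (by linarith)
    have h2 : β j n ^ (-(q / 2)) ≤ (D⁻¹ * ((n:ℝ) + 1) ^ r * τ j ^ (2 * m)) ^ (-(q / 2)) :=
      Real.rpow_le_rpow_of_nonpos (by positivity) hB (by linarith)
    have h3 : (D⁻¹ * ((n:ℝ) + 1) ^ r * τ j ^ (2 * m)) ^ (-(q / 2))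
        = D ^ (q / 2) * ((n:ℝ) + 1) ^ (-(r * q / 2)) * (τ j ^ (-q)) ^ m := by
      rw [Real.mul_rpow (by positivity) (by positivity),
        Real.mul_rpow (by positivity) (by positivity)]
      congr 1
      · congr 1
        · rw [Real.inv_rpow hD0.le, Real.rpow_neg hD0.le, inv_inv]
        · rw [← Real.rpow_natCast, ← Real.rpow_mul hn1.le]
          congr 1; ring
      · rw [← Real.rpow_natCast, ← Real.rpow_natCast, ← Real.rpow_mul ht.le,
          ← Real.rpow_mul ht.le]
        congr 1; push_cast; ring
    have h4 : (τ j ^ (-q)) ^ m ≤ M ^ r * τ j ^ (-q) := by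
      obtain ⟨k, hk⟩ : ∃ k, m = k + 1 := ⟨m - 1, by omega⟩
      rw [hk, pow_succ]
      refine mul_le_mul_of_nonneg_right ?_ (hx0 j).le
      exact (pow_le_pow_left₀ (hx0 j).le (hxM j) k).trans (pow_le_pow_right₀ hM1 (by omega))
    have h5 : ((n:ℝ) + 1) ^ (6 - r * q / 2) = (((1:ℝ) + n) ^ 3) ^ 2 * ((n:ℝ) + 1) ^ (-(r * q / 2)) := by
      rw [sub_eq_add_neg, Real.rpow_add hn1, ← pow_mul, add_comm (1:ℝ)]
      congr 1
      exact_mod_cast Real.rpow_natCast ((n:ℝ) + 1) 6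
    calc (((1:ℝ) + n) ^ 3) ^ 2 * β j n ^ (-(2 * η))
        ≤ (((1:ℝ) + n) ^ 3) ^ 2 *
          (D ^ (q / 2) * ((n:ℝ) + 1) ^ (-(r * q / 2)) * (M ^ r * τ j ^ (-q))) := by
          refine mul_le_mul_of_nonneg_left ?_ (by positivity)
          refine (h1.trans h2).trans (h3.le.trans ?_)
          exact mul_le_mul_of_nonneg_left h4 (by positivity)
      _ = _ := by rw [h5]; ring
end

section
/- Let r be a positive integer, η > 0 with 2ηr > 7, and τ > 0. Define C_{r,η} := Σ_{n≥r} (1+n)^{6} binom(n,r)^{−2η}, which is finite. Then Σ_{n=0}^{∞} (1+n)^{6} · (Σ_{l=0}^{r} binom(n,l) τ^{2l})^{−2η} ≤ 1 + Σ_{n=1}^{r−1} (1+n)^{6} τ^{−4ηn} + C_{r,η} τ^{−4ηr}. -/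
open MeasureTheory ProbabilityTheory

variable {E : Type*} [NormedAddCommGroup E] [NormedSpace ℝ E]

lemma odf_choose (r n : ℕ) (h : r ≤ n) :
    ((r + 1 : ℝ) ^ r * r.factorial)⁻¹ * ((1 : ℝ) + n) ^ r ≤ (n.choose r : ℝ) := by
  have h1 := Nat.pow_le_choose (α := ℝ) r n
  have h2 : ((1 : ℝ) + n) ≤ (r + 1) * ((n + 1 - r : ℕ) : ℝ) := by
    rw [Nat.cast_sub (by omega)]
    have : (r : ℝ) ≤ n := by exact_mod_cast h
    push_cast
    nlinarith [mul_nonneg (Nat.cast_nonneg (α := ℝ) r) (sub_nonneg.2 this)]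
  have h3 : ((1 : ℝ) + n) ^ r ≤ (r + 1 : ℝ) ^ r * ((n + 1 - r : ℕ) : ℝ) ^ r := by
    rw [← mul_pow]
    exact pow_le_pow_left₀ (by positivity) h2 r
  have hf : (0 : ℝ) < r.factorial := by exact_mod_cast r.factorial_pos
  rw [inv_mul_le_iff₀ (by positivity)]
  refine h3.trans ?_
  rw [mul_assoc]
  apply mul_le_mul_of_nonneg_left _ (by positivity)
  have h4 : (((n + 1 - r : ℕ) : ℝ) ^ r) / r.factorial ≤ n.choose r := by
    first
      | exact_mod_cast h1
      | (rw [div_le_iff₀' hf]; exact_mod_cast h1)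
  rwa [div_le_iff₀' hf] at h4

lemma odf_summable (r : ℕ) (η : ℝ) (hη : 0 < η) (h7 : 7 < 2 * η * r) :
    Summable (fun n : ℕ => if r ≤ n then
        ((1 : ℝ) + n) ^ 6 * ((n.choose r : ℝ)) ^ (-(2 * η)) else 0) := by
  set c : ℝ := ((r + 1 : ℝ) ^ r * r.factorial)⁻¹ with hc
  have hf : (0 : ℝ) < r.factorial := by exact_mod_cast r.factorial_pos
  have hc0 : 0 < c := by positivity
  have hs : Summable (fun n : ℕ => c ^ (-(2 * η)) * ((n + 1 : ℕ) : ℝ) ^ (6 - 2 * η * r)) := by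
    apply Summable.mul_left
    exact (summable_nat_add_iff (f := fun n : ℕ => (n : ℝ) ^ (6 - 2 * η * r)) 1).2
      (Real.summable_nat_rpow.2 (by linarith))
  refine Summable.of_nonneg_of_le (fun n => ?_) (fun n => ?_) hs
  · split_ifs <;> positivity
  · split_ifs with h
    · have hn : (0 : ℝ) < 1 + n := by positivity
      have h1 : (n.choose r : ℝ) ^ (-(2 * η)) ≤ (c * ((1 : ℝ) + n) ^ r) ^ (-(2 * η)) :=
        Real.rpow_le_rpow_of_nonpos (by positivity) (odf_choose r n h) (by linarith)
      rw [Real.mul_rpow hc0.le (by positivity), ← Real.rpow_natCast _ r,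
        ← Real.rpow_mul hn.le] at h1
      calc _ ≤ ((1 : ℝ) + n) ^ 6 * (c ^ (-(2 * η)) * ((1 : ℝ) + n) ^ ((r : ℝ) * -(2 * η))) := by
            gcongr
        _ = _ := by
            have : ((n + 1 : ℕ) : ℝ) = 1 + n := by push_cast; ring
            rw [this, show (6 - 2 * η * r : ℝ) = ((6 : ℕ) : ℝ) + (r : ℝ) * -(2 * η) by
              push_cast; ring, Real.rpow_add hn, Real.rpow_natCast]
            ring
    · positivity

lemma odf_term (r m n : ℕ) (hm : m ≤ r) (hmn : m ≤ n) (η : ℝ) (hη : 0 < η) (τ : ℝ) (hτ : 0 < τ) :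
    (∑ l ∈ Finset.range (r + 1), (n.choose l : ℝ) * τ ^ (2 * l)) ^ (-(2 * η)) ≤
      (n.choose m : ℝ) ^ (-(2 * η)) * τ ^ (-(4 * η * m)) := by
  have hp : (0 : ℝ) < n.choose m := by exact_mod_cast Nat.choose_pos hmn
  have h1 : (n.choose m : ℝ) * τ ^ (2 * m) ≤
      ∑ l ∈ Finset.range (r + 1), (n.choose l : ℝ) * τ ^ (2 * l) :=
    Finset.single_le_sum (f := fun l => (n.choose l : ℝ) * τ ^ (2 * l))
      (fun l _ => by positivity) (Finset.mem_range.2 (by omega))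
  refine (Real.rpow_le_rpow_of_nonpos (by positivity) h1 (by linarith)).trans (le_of_eq ?_)
  rw [Real.mul_rpow hp.le (by positivity), ← Real.rpow_natCast τ, ← Real.rpow_mul hτ.le]
  congr 2
  push_cast; ring

/-- One-dimensional factor estimate: the series `Σ_n (1+n)⁶ (Σ_{l≤r} binom(n,l) τ^{2l})^{-2η}`
converges and is bounded by `1 + Σ_{n=1}^{r-1} (1+n)⁶ τ^{-4ηn} + C_{r,η} τ^{-4ηr}`. -/
theorem one_dim_factor_bound (r : ℕ) (hr : 0 < r) (η : ℝ) (hη : 0 < η)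
    (h7 : 7 < 2 * η * r) (τ : ℝ) (hτ : 0 < τ) :
    Summable (fun n : ℕ => if r ≤ n then
        ((1 : ℝ) + n) ^ 6 * ((n.choose r : ℝ)) ^ (-(2 * η)) else 0) ∧
    Summable (fun n : ℕ => ((1 : ℝ) + n) ^ 6 *
        (∑ l ∈ Finset.range (r + 1), (n.choose l : ℝ) * τ ^ (2 * l)) ^ (-(2 * η))) ∧
    (∑' n : ℕ, ((1 : ℝ) + n) ^ 6 *
        (∑ l ∈ Finset.range (r + 1), (n.choose l : ℝ) * τ ^ (2 * l)) ^ (-(2 * η))) ≤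
      1 + (∑ n ∈ Finset.Ico 1 r, ((1 : ℝ) + n) ^ 6 * τ ^ (-(4 * η * n))) +
        (∑' n : ℕ, if r ≤ n then
          ((1 : ℝ) + n) ^ 6 * ((n.choose r : ℝ)) ^ (-(2 * η)) else 0) * τ ^ (-(4 * η * r)) := by
  have hS := odf_summable r η hη h7
  set G : ℕ → ℝ := fun n : ℕ => if r ≤ n then
        ((1 : ℝ) + n) ^ 6 * ((n.choose r : ℝ)) ^ (-(2 * η)) else 0 with hG
  set F : ℕ → ℝ := fun n : ℕ => ((1 : ℝ) + n) ^ 6 *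
        (∑ l ∈ Finset.range (r + 1), (n.choose l : ℝ) * τ ^ (2 * l)) ^ (-(2 * η)) with hF
  let K : ℕ → ℝ := fun n => if n ∈ Finset.range r then
    ((1 : ℝ) + n) ^ 6 * τ ^ (-(4 * η * n)) else 0
  have hK : HasSum K (∑ n ∈ Finset.range r, ((1 : ℝ) + n) ^ 6 * τ ^ (-(4 * η * n))) := by
    have h := hasSum_sum_of_ne_finset_zero (f := K) (s := Finset.range r) (L := SummationFilter.unconditional ℕ)
      (fun n hn => if_neg hn)
    rwa [Finset.sum_congr rfl (fun n hn => if_pos hn)] at h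
  have hH := hK.add (hS.hasSum.mul_right (τ ^ (-(4 * η * r))))
  have hF0 : ∀ n, 0 ≤ F n := fun n => by simp only [hF]; positivity
  have hle : ∀ n, F n ≤ K n + G n * τ ^ (-(4 * η * r)) := by
    intro n
    by_cases h : r ≤ n
    · have := odf_term r r n le_rfl h η hη τ hτ
      simp only [hF, hG, K, Finset.mem_range, not_lt.2 h, h, if_true, if_false, zero_add]
      rw [mul_assoc]
      gcongr
    · have := odf_term r n n (by omega) le_rfl η hη τ hτ
      simp only [hF, hG, K, Finset.mem_range, not_le.1 h, h, if_true, if_false, zero_mul, add_zero]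
      simp only [Nat.choose_self, Nat.cast_one, Real.one_rpow, one_mul] at this
      gcongr
  have hFs : Summable F := Summable.of_nonneg_of_le hF0 hle hH.summable
  refine ⟨hS, hFs, ?_⟩
  refine (hasSum_le hle hFs.hasSum hH).trans (le_of_eq ?_)
  rw [Finset.range_eq_Ico, Finset.sum_eq_sum_Ico_succ_bot hr]
  simp
end

section
/- Let a : ℕ → ℕ → [0,∞] be a family of extended nonnegative reals with a_j(0) = 1 for every j. Then Σ_{ν∈F} ∏_{j∈supp ν} a_j(ν_j) = ∏_{j≥1} (Σ_{n=0}^{∞} a_j(n)), where the sum over F, the inner sums, and the infinite product are taken in the extended nonnegative reals [0,∞]. -/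
open MeasureTheory ProbabilityTheory

variable {E : Type*} [NormedAddCommGroup E] [NormedSpace ℝ E]

theorem aux_insert (a : ℕ → ℕ → ENNReal) (ha : ∀ j, a j 0 = 1) (s : Finset ℕ) :
    ∑' ν : {ν : ℕ →₀ ℕ // ν.support ⊆ s}, ∏ j ∈ s, a j (ν.1 j) = ∏ j ∈ s, ∑' n : ℕ, a j n := by
  classical
  induction s using Finset.induction_on with
  | empty =>
    rw [tsum_eq_single (⟨0, by simp⟩ : {ν : ℕ →₀ ℕ // ν.support ⊆ ∅})]
    · simp
    · rintro ⟨ν, hν⟩ h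
      exfalso
      apply h
      apply Subtype.ext
      simpa using hν
  | insert i s hi ih =>
    let e : ℕ × {ν : ℕ →₀ ℕ // ν.support ⊆ s} ≃ {ν : ℕ →₀ ℕ // ν.support ⊆ insert i s} :=
      { toFun := fun p => ⟨p.2.1.update i p.1, by
          intro j hj
          by_cases h : j = i
          · simp [h]
          · have : p.2.1 j ≠ 0 := by simpa [Function.update_of_ne h] using hj
            exact Finset.mem_insert_of_mem (p.2.2 (Finsupp.mem_support_iff.2 this))⟩
        invFun := fun ν => (ν.1 i, ⟨ν.1.erase i, by
          intro j hj
          rw [Finsupp.support_erase, Finset.mem_erase] at hj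
          exact (Finset.mem_insert.1 (ν.2 hj.2)).resolve_left hj.1⟩)
        left_inv := by
          rintro ⟨n, μ, hμ⟩
          have h0 : μ i = 0 := by
            by_contra h
            exact hi (hμ (Finsupp.mem_support_iff.2 h))
          refine Prod.ext (by simp) (Subtype.ext ?_)
          ext j
          by_cases h : j = i
          · subst h; simp [h0]
          · simp [Finsupp.erase_ne h, Function.update_of_ne h]
        right_inv := by
          rintro ⟨ν, hν⟩
          apply Subtype.ext
          ext j
          by_cases h : j = i
          · subst h; simp
          · simp [Finsupp.erase_ne h, Function.update_of_ne h] }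
    rw [← e.tsum_eq, ENNReal.tsum_prod', Finset.prod_insert hi, ← ih, ← ENNReal.tsum_mul_right]
    refine tsum_congr fun n => ?_
    rw [← ENNReal.tsum_mul_left]
    refine tsum_congr fun μ => ?_
    rw [Finset.prod_insert hi]
    congr 1
    · simp [e]
    · refine Finset.prod_congr rfl fun j hj => ?_
      have h : j ≠ i := fun h => hi (h ▸ hj)
      simp [e, Function.update_of_ne h]

/-- Factorization of sums over finitely supported multi-indices:
`Σ_{ν∈F} ∏_{j∈supp ν} a_j(ν_j) = ∏_j Σ_n a_j(n)` in `[0,∞]`, provided `a_j(0) = 1`. -/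
theorem tsum_finsupp_prod_eq_tprod (a : ℕ → ℕ → ENNReal) (ha : ∀ j, a j 0 = 1) :
    ∑' ν : ℕ →₀ ℕ, ∏ j ∈ ν.support, a j (ν j) = ∏' j : ℕ, ∑' n : ℕ, a j n := by
  classical
  have key : ∀ s : Finset ℕ, ∑' ν : {ν : ℕ →₀ ℕ // ν.support ⊆ s}, ∏ j ∈ ν.1.support, a j (ν.1 j)
      = ∏ j ∈ s, ∑' n : ℕ, a j n := by
    intro s
    rw [← aux_insert a ha s]
    refine tsum_congr fun ν => Finset.prod_subset ν.2 fun j _ hj => ?_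
    rw [Finsupp.notMem_support_iff.1 hj, ha]
  have hone : ∀ j, 1 ≤ ∑' n : ℕ, a j n := fun j => (ha j).symm.le.trans (ENNReal.le_tsum 0)
  have hmono : Monotone fun s : Finset ℕ => ∏ j ∈ s, ∑' n : ℕ, a j n := fun s t hst =>
    Finset.prod_le_prod_of_subset_of_one_le' hst fun j _ _ => hone j
  have hp : HasProd (fun j => ∑' n : ℕ, a j n)
      (∑' ν : ℕ →₀ ℕ, ∏ j ∈ ν.support, a j (ν j)) := by
    refine tendsto_atTop_isLUB hmono ⟨?_, ?_⟩
    · rintro _ ⟨s, rfl⟩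
      change ∏ j ∈ s, ∑' n : ℕ, a j n ≤ _
      rw [← key]
      exact ENNReal.tsum_comp_le_tsum_of_injective Subtype.val_injective
        (fun ν : ℕ →₀ ℕ => ∏ j ∈ ν.support, a j (ν j))
    · intro b hb
      rw [ENNReal.tsum_eq_iSup_sum]
      refine iSup_le fun T => ?_
      refine le_trans ?_ (hb ⟨T.biUnion Finsupp.support, rfl⟩)
      change _ ≤ ∏ j ∈ T.biUnion Finsupp.support, ∑' n : ℕ, a j n
      rw [← key]
      have hT : ∀ ν ∈ T, ν.support ⊆ T.biUnion Finsupp.support := fun ν hν =>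
        Finset.subset_biUnion_of_mem _ hν
      rw [← Finset.sum_subtype_of_mem (p := fun ν : ℕ →₀ ℕ =>
        ν.support ⊆ T.biUnion Finsupp.support) _ hT]
      exact ENNReal.sum_le_tsum _
  exact hp.tprod_eq.symm
end

section
/- Let 0 < q < 2, let (τ_j)_{j≥1} be positive reals with Σ_{j≥1} τ_j^{−q} < ∞, let r be a positive integer with r > 14/q, and define b_ν = ∏_{j≥1} Σ_{l=0}^{r} binom(ν_j, l) τ_j^{2l} and c_ν = ∏_{j∈supp ν} (1+ν_j)³ for ν ∈ F. Let (a_ν)_{ν∈F} be nonnegative reals with Σ_{ν∈F} b_ν a_ν² < ∞. Then there exists a constant C < ∞ such that for every N ≥ 1 there exists a downward closed set Λ_N ⊆ F of cardinality N (consisting of indices attaining the N smallest values of b_ν) with Σ_{ν∈F∖Λ_N} c_ν a_ν ≤ C (N+1)^{−s}, where s = 1/q − 1/2. -/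
open MeasureTheory ProbabilityTheory

variable {E : Type*} [NormedAddCommGroup E] [NormedSpace ℝ E]

noncomputable def BB (r : ℕ) (t : ℝ) (n : ℕ) : ℝ :=
  ∑ l ∈ Finset.range (r + 1), ((n.choose l : ℕ) : ℝ) * t ^ (2 * l)

lemma BB_zero (r : ℕ) (t : ℝ) : BB r t 0 = 1 := by
  unfold BB
  rw [Finset.sum_range_succ']
  simp

lemma BB_one_le (r : ℕ) (t : ℝ) (ht : 0 < t) (n : ℕ) : 1 ≤ BB r t n := by
  unfold BB
  rw [Finset.sum_range_succ']
  simp only [Nat.choose_zero_right, Nat.cast_one, mul_zero, pow_zero, mul_one]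
  have : 0 ≤ ∑ k ∈ Finset.range r, ((n.choose (k+1) : ℕ) : ℝ) * t ^ (2 * (k+1)) :=
    Finset.sum_nonneg fun i _ => by positivity
  linarith

lemma BB_mono (r : ℕ) (t : ℝ) (ht : 0 < t) {m n : ℕ} (h : m ≤ n) : BB r t m ≤ BB r t n := by
  unfold BB
  refine Finset.sum_le_sum fun l _ => ?_
  have : m.choose l ≤ n.choose l := Nat.choose_le_choose l h
  have : ((m.choose l : ℕ) : ℝ) ≤ ((n.choose l : ℕ) : ℝ) := by exact_mod_cast this
  gcongr

lemma choose_low (r n : ℕ) :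
    (n + 1) ^ r ≤ ((r + 1) ^ r * r.factorial) * n.choose (min n r) := by
  rcases le_total n r with h | h
  · rw [min_eq_left h, Nat.choose_self, mul_one]
    calc (n + 1) ^ r ≤ (r + 1) ^ r := Nat.pow_le_pow_left (by omega) r
      _ ≤ _ := Nat.le_mul_of_pos_right _ (Nat.factorial_pos r)
  · rw [min_eq_right h]
    have h1 : (n + 1 - r) ^ r ≤ r.factorial * n.choose r := by
      have h0 := Nat.pow_le_choose (α := ℝ) r n
      rw [div_le_iff₀ (by positivity), mul_comm] at h0
      exact_mod_cast h0
    have h2 : n + 1 ≤ (r + 1) * (n + 1 - r) := by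
      obtain ⟨k, rfl⟩ := Nat.exists_eq_add_of_le h
      have : r + k + 1 - r = k + 1 := by omega
      rw [this]; nlinarith
    calc (n + 1) ^ r ≤ ((r + 1) * (n + 1 - r)) ^ r := Nat.pow_le_pow_left h2 r
      _ = (r + 1) ^ r * (n + 1 - r) ^ r := by rw [mul_pow]
      _ ≤ (r + 1) ^ r * (r.factorial * n.choose r) := Nat.mul_le_mul_left _ h1
      _ = _ := by ring

lemma BB_low (r : ℕ) (hr : 0 < r) (δ t : ℝ) (hδ : 0 < δ) (hδ1 : δ ≤ 1) (hδt : δ ≤ t)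
    (n : ℕ) (hn : 1 ≤ n) :
    δ ^ (2 * r) / ((r + 1 : ℝ) ^ r * r.factorial) * (((1 : ℝ) + n) ^ r * t ^ 2) ≤ BB r t n := by
  have ht : 0 < t := hδ.trans_le hδt
  have h1 : ((n.choose (min n r) : ℕ) : ℝ) * t ^ (2 * min n r) ≤ BB r t n := by
    unfold BB
    exact Finset.single_le_sum (f := fun l => ((n.choose l : ℕ) : ℝ) * t ^ (2 * l))
      (fun i _ => by positivity) (Finset.mem_range.2 (by omega))
  refine le_trans ?_ h1
  have h2 : ((1 : ℝ) + n) ^ r ≤ ((r + 1 : ℝ) ^ r * r.factorial) * (n.choose (min n r) : ℕ) := by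
    have := choose_low r n
    rw [add_comm]
    exact_mod_cast this
  have h3 : δ ^ (2 * r) * t ^ 2 ≤ t ^ (2 * min n r) := by
    obtain ⟨k, hk⟩ : ∃ k, min n r = k + 1 := ⟨min n r - 1, by omega⟩
    rw [hk]
    have : δ ^ (2 * r) ≤ δ ^ (2 * k) := pow_le_pow_of_le_one hδ.le hδ1 (by omega)
    have h4 : δ ^ (2 * k) ≤ t ^ (2 * k) := pow_le_pow_left₀ hδ.le hδt _
    calc δ ^ (2 * r) * t ^ 2 ≤ t ^ (2 * k) * t ^ 2 := by gcongr; exact this.trans h4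
      _ = _ := by rw [← pow_add]; rfl
  have hD : (0 : ℝ) < (r + 1 : ℝ) ^ r * r.factorial := by positivity
  rw [div_mul_eq_mul_div, div_le_iff₀ hD]
  calc δ ^ (2 * r) * (((1 : ℝ) + n) ^ r * t ^ 2) = ((1 : ℝ) + n) ^ r * (δ ^ (2 * r) * t ^ 2) := by ring
    _ ≤ (((r + 1 : ℝ) ^ r * r.factorial) * (n.choose (min n r) : ℕ)) * t ^ (2 * min n r) := by
        gcongr
    _ = _ := by ring

lemma prod_ext (F : ℕ → ℕ → ℝ) (hF0 : ∀ j, F j 0 = 1) (ν : ℕ →₀ ℕ) (s : Finset ℕ)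
    (hs : ν.support ⊆ s) : ∏ j ∈ ν.support, F j (ν j) = ∏ j ∈ s, F j (ν j) := by
  refine Finset.prod_subset hs fun j _ hj => ?_
  rw [Finsupp.notMem_support_iff.1 hj, hF0]

lemma summable_prod (F : ℕ → ℕ → ℝ) (hF0 : ∀ j, F j 0 = 1) (hF : ∀ j n, 0 ≤ F j n)
    (t g : ℕ → ℝ) (ht0 : ∀ j, 0 ≤ t j) (hg0 : ∀ n, 0 ≤ g n) (ht : Summable t) (hg : Summable g)
    (hle : ∀ j n, 1 ≤ n → F j n ≤ t j * g n) :
    Summable fun ν : ℕ →₀ ℕ => ∏ j ∈ ν.support, F j (ν j) := by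
  refine summable_of_sum_le (c := Real.exp ((∑' j, t j) * ∑' n, g n))
    (fun ν => Finset.prod_nonneg fun j _ => hF _ _) fun S => ?_
  obtain ⟨M, hM⟩ : ∃ M, ∀ ν ∈ S, ν.support ⊆ Finset.range M := by
    obtain ⟨M, hM⟩ := (S.biUnion fun ν => ν.support).exists_nat_subset_range
    exact ⟨M, fun ν hν => (Finset.subset_biUnion_of_mem (fun ν : ℕ →₀ ℕ => ν.support) hν).trans hM⟩
  obtain ⟨L, hL⟩ : ∃ L, ∀ ν ∈ S, ∀ j, ν j < L := by
    refine ⟨(S.sup fun ν => ν.degree) + 1, fun ν hν j => ?_⟩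
    have h1 : ν j ≤ ν.degree := Finsupp.le_degree j ν
    have h2 : ν.degree ≤ S.sup fun ν => ν.degree := Finset.le_sup (f := fun ν : ℕ →₀ ℕ => ν.degree) hν
    omega
  set φ : (ℕ →₀ ℕ) → (Fin M → ℕ) := fun ν i => ν i with hφ
  have hinj : Set.InjOn φ (S : Set (ℕ →₀ ℕ)) := by
    intro ν hν μ hμ h
    ext j
    by_cases hj : j < M
    · exact congrFun h ⟨j, hj⟩
    · have h1 : j ∉ ν.support := fun hh => hj (Finset.mem_range.1 (hM ν hν hh))
      have h2 : j ∉ μ.support := fun hh => hj (Finset.mem_range.1 (hM μ hμ hh))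
      rw [Finsupp.notMem_support_iff.1 h1, Finsupp.notMem_support_iff.1 h2]
  calc ∑ ν ∈ S, ∏ j ∈ ν.support, F j (ν j) 
      = ∑ ν ∈ S, ∏ i : Fin M, F i (φ ν i) := by
        refine Finset.sum_congr rfl fun ν hν => ?_
        rw [prod_ext F hF0 ν _ (hM ν hν), Finset.prod_range]
    _ = ∑ p ∈ S.image φ, ∏ i : Fin M, F i (p i) := by
        rw [Finset.sum_image hinj]
    _ ≤ ∑ p ∈ Fintype.piFinset (fun _ : Fin M => Finset.range L), ∏ i : Fin M, F i (p i) := by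
        refine Finset.sum_le_sum_of_subset_of_nonneg ?_
          fun p _ _ => Finset.prod_nonneg fun j _ => hF _ _
        intro p hp
        obtain ⟨ν, hν, rfl⟩ := Finset.mem_image.1 hp
        exact Fintype.mem_piFinset.2 fun i => Finset.mem_range.2 (hL ν hν _)
    _ = ∏ i : Fin M, ∑ n ∈ Finset.range L, F i n := by
        rw [Finset.prod_univ_sum]
    _ ≤ ∏ i : Fin M, Real.exp (t i * ∑' n, g n) := by
        refine Finset.prod_le_prod (fun i _ => Finset.sum_nonneg fun n _ => hF _ _) fun i _ => ?_
        have : ∑ n ∈ Finset.range L, F i n ≤ 1 + t i * ∑' n, g n := by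
          calc ∑ n ∈ Finset.range L, F i n ≤ ∑ n ∈ Finset.range (L + 1), F i n :=
                Finset.sum_le_sum_of_subset_of_nonneg (Finset.range_mono (by omega))
                  fun _ _ _ => hF _ _
            _ = ∑ n ∈ Finset.range L, F i (n + 1) + 1 := by
                rw [Finset.sum_range_succ', hF0]
            _ ≤ ∑ n ∈ Finset.range L, t i * g (n + 1) + 1 := by
                gcongr with n hn
                exact hle _ _ (by omega)
            _ ≤ t i * ∑ n ∈ Finset.range (L + 1), g n + 1 := by
                rw [← Finset.mul_sum, Finset.sum_range_succ' g]
                have := hg0 0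
                gcongr
                · exact ht0 _
                · linarith
            _ ≤ t i * ∑' n, g n + 1 := by
                gcongr
                · exact ht0 _
                · exact hg.sum_le_tsum _ fun n _ => hg0 n
            _ = _ := by ring
        refine this.trans ?_
        linarith [Real.add_one_le_exp (t i * ∑' n, g n)]
    _ = Real.exp ((∑ j ∈ Finset.range M, t j) * ∑' n, g n) := by
        rw [← Real.exp_sum, ← Finset.sum_mul, Finset.sum_range]
    _ ≤ _ := by
        refine Real.exp_le_exp.2 ?_
        gcongr
        · exact tsum_nonneg hg0
        · exact ht.sum_le_tsum _ fun n _ => ht0 n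

lemma exists_delta (q : ℝ) (hq0 : 0 < q) (τ : ℕ → ℝ) (hτ : ∀ j, 0 < τ j)
    (hτq : Summable fun j : ℕ => τ j ^ (-q)) : ∃ δ : ℝ, 0 < δ ∧ δ ≤ 1 ∧ ∀ j, δ ≤ τ j := by
  set T := ∑' j, τ j ^ (-q) with hT
  have hnn : ∀ j, 0 ≤ τ j ^ (-q) := fun j => Real.rpow_nonneg (hτ j).le _
  have hT0 : 0 ≤ T := tsum_nonneg hnn
  refine ⟨(T + 1) ^ (-(1/q)), by positivity, ?_, fun j => ?_⟩
  · exact Real.rpow_le_one_of_one_le_of_nonpos (by linarith) (by simp; exact hq0.le)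
  · have h1 : τ j ^ (-q) ≤ T + 1 := by
      have := hτq.le_tsum j fun i _ => hnn i
      linarith
    have h2 : (T + 1) ^ (-(1/q)) ≤ (τ j ^ (-q)) ^ (-(1/q)) :=
      Real.rpow_le_rpow_of_nonpos (Real.rpow_pos_of_pos (hτ j) _) h1
        (by simp; exact hq0.le)
    rw [← Real.rpow_mul (hτ j).le] at h2
    have : -q * -(1/q) = 1 := by field_simp
    rwa [this, Real.rpow_one] at h2

lemma prod_ge_one {s : Finset ℕ} {f : ℕ → ℝ} (h : ∀ j ∈ s, 1 ≤ f j) : 1 ≤ ∏ j ∈ s, f j := by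
  calc (1 : ℝ) = ∏ j ∈ s, (1 : ℝ) := by simp
    _ ≤ _ := Finset.prod_le_prod (fun _ _ => zero_le_one) h

lemma bwt_eq (r : ℕ) (τ : ℕ → ℝ) (ν : ℕ →₀ ℕ) :
    bwt r τ ν = ∏ j ∈ ν.support, BB r (τ j) (ν j) := rfl

lemma one_le_bwt (r : ℕ) (τ : ℕ → ℝ) (hτ : ∀ j, 0 < τ j) (ν : ℕ →₀ ℕ) : 1 ≤ bwt r τ ν := by
  rw [bwt_eq]
  exact prod_ge_one fun j _ => BB_one_le r _ (hτ j) _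

lemma one_le_cwt (ν : ℕ →₀ ℕ) : 1 ≤ cwt ν := by
  unfold cwt
  exact prod_ge_one fun j _ => one_le_pow₀ (by simp)

lemma bwt_mono (r : ℕ) (τ : ℕ → ℝ) (hτ : ∀ j, 0 < τ j) {μ ν : ℕ →₀ ℕ} (h : μ ≤ ν) :
    bwt r τ μ ≤ bwt r τ ν := by
  rw [bwt_eq, bwt_eq, prod_ext (fun j => BB r (τ j)) (fun j => BB_zero _ _) μ ν.support
    (Finsupp.support_mono h)]
  exact Finset.prod_le_prod (fun j _ => zero_le_one.trans (BB_one_le r _ (hτ j) _))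
    fun j _ => BB_mono r _ (hτ j) (h j)

lemma summable_W (q : ℝ) (hq0 : 0 < q)
    (τ : ℕ → ℝ) (hτ : ∀ j, 0 < τ j)
    (hτq : Summable fun j : ℕ => τ j ^ (-q))
    (r : ℕ) (hr : 0 < r) (hrq : 14 / q < (r : ℝ)) :
    Summable fun ν : ℕ →₀ ℕ => cwt ν ^ 2 * bwt r τ ν ^ (-(q / 2)) := by
  obtain ⟨δ, hδ, hδ1, hδτ⟩ := exists_delta q hq0 τ hτ hτq
  set κ : ℝ := δ ^ (2 * r) / ((r + 1 : ℝ) ^ r * r.factorial) with hκ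
  have hκ0 : 0 < κ := by positivity
  have hBpos : ∀ j n, 0 < BB r (τ j) n := fun j n => zero_lt_one.trans_le (BB_one_le r _ (hτ j) _)
  have key := summable_prod (fun j n => ((1 : ℝ) + n) ^ 6 * BB r (τ j) n ^ (-(q / 2)))
    (fun j => by simp [BB_zero])
    (fun j n => by have := hBpos j n; positivity)
    (fun j => τ j ^ (-q)) (fun n => κ ^ (-(q / 2)) * ((1 : ℝ) + n) ^ (6 - r * (q / 2)))
    (fun j => Real.rpow_nonneg (hτ j).le _) (fun n => by positivity) hτq
    (by
      refine Summable.mul_left _ ?_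
      have h14 : 14 < r * q := by rwa [div_lt_iff₀ hq0] at hrq
      have h := (summable_nat_add_iff 1).2
        (Real.summable_nat_rpow (p := 6 - r * (q / 2)) |>.2 (by linarith))
      refine h.congr fun n => ?_
      push_cast
      rw [add_comm])
    (by
      intro j n hn
      have h1 := BB_low r hr δ (τ j) hδ hδ1 (hδτ j) n hn
      have hτj := hτ j
      have h2 : BB r (τ j) n ^ (-(q / 2)) ≤ (κ * (((1 : ℝ) + n) ^ r * τ j ^ 2)) ^ (-(q / 2)) :=
        Real.rpow_le_rpow_of_nonpos (by positivity) h1 (by linarith)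
      have hn1 : (0 : ℝ) < 1 + n := by positivity
      have h3 : (κ * (((1 : ℝ) + n) ^ r * τ j ^ 2)) ^ (-(q / 2))
          = κ ^ (-(q / 2)) * (((1 : ℝ) + n) ^ (-(r * (q / 2))) * τ j ^ (-q)) := by
        rw [Real.mul_rpow hκ0.le (by positivity), Real.mul_rpow (by positivity) (by positivity),
          ← Real.rpow_natCast _ r, ← Real.rpow_mul hn1.le, ← Real.rpow_natCast _ 2,
          ← Real.rpow_mul hτj.le]
        congr 3
        · ring
        · push_cast; ring
      rw [h3] at h2
      have h4 : ((1 : ℝ) + n) ^ (6 - r * (q / 2)) = ((1 : ℝ) + n) ^ 6 * ((1 : ℝ) + n) ^ (-(r * (q / 2))) := by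
        rw [sub_eq_add_neg, Real.rpow_add hn1]
        norm_cast
      rw [h4]
      calc ((1 : ℝ) + n) ^ 6 * BB r (τ j) n ^ (-(q / 2)) ≤ ((1 : ℝ) + n) ^ 6 * (κ ^ (-(q / 2)) * (((1 : ℝ) + n) ^ (-(r * (q / 2))) * τ j ^ (-q))) := by
            gcongr
        _ = _ := by ring)
  refine key.congr fun ν => ?_
  rw [bwt_eq, cwt, ← Real.finsetProd_rpow _ _ (fun j _ => (hBpos _ _).le), ← Finset.prod_pow,
    ← Finset.prod_mul_distrib]
  refine Finset.prod_congr rfl fun j _ => ?_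
  rw [← pow_mul]

lemma exists_set (b : (ℕ →₀ ℕ) → ℝ) (hmono : ∀ μ ν, μ ≤ ν → b μ ≤ b ν)
    (hfin : ∀ x, {ν | b ν ≤ x}.Finite) (N : ℕ) :
    ∃ Λ : Finset (ℕ →₀ ℕ), DownwardClosed (↑Λ : Set (ℕ →₀ ℕ)) ∧ Λ.card = N ∧
      (∀ ν ∈ Λ, ∀ μ : ℕ →₀ ℕ, μ ∉ Λ → b ν ≤ b μ) := by
  classical
  induction N with
  | zero => exact ⟨∅, by intro ν hν; simp at hν, rfl, by simp⟩
  | succ N ih =>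
    obtain ⟨Λ, hd, hc, hmin⟩ := ih
    obtain ⟨ν0, hν0⟩ := Infinite.exists_notMem_finset Λ
    have hfin' : {ν | ν ∉ Λ ∧ b ν ≤ b ν0}.Finite := (hfin (b ν0)).subset fun ν h => h.2
    obtain ⟨ν1, ⟨h1, h1b⟩, hm⟩ := Set.exists_min_image _
      (fun ν : ℕ →₀ ℕ => (toLex (b ν, ν.degree) : ℝ ×ₗ ℕ)) hfin' ⟨ν0, hν0, le_rfl⟩
    have hle : ∀ μ, μ ∉ Λ → b ν1 ≤ b μ := by
      intro μ hμ
      by_cases h : b μ ≤ b ν0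
      · have := hm μ ⟨hμ, h⟩
        rw [Prod.Lex.toLex_le_toLex] at this
        rcases this with h | h
        · exact h.le
        · exact h.1.le
      · exact h1b.trans (not_le.1 h).le
    refine ⟨insert ν1 Λ, ?_, by rw [Finset.card_insert_of_notMem h1, hc], ?_⟩
    · intro ν hν μ hμ
      rw [Finset.mem_coe, Finset.mem_insert] at hν ⊢
      rcases hν with rfl | hν
      · by_contra hcon
        push Not at hcon
        have h3 := hm μ ⟨hcon.2, (hmono _ _ hμ).trans h1b⟩
        rw [Prod.Lex.toLex_le_toLex] at h3
        rcases h3 with h | h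
        · exact absurd (hmono _ _ hμ) (not_le.2 h)
        · apply hcon.1
          have h4 : ν.degree ≤ μ.degree := h.2
          obtain ⟨d, rfl⟩ := exists_add_of_le hμ
          rw [map_add] at h4
          have : d.degree = 0 := by omega
          rw [Finsupp.degree_eq_zero_iff] at this
          simp [this]
      · exact Or.inr (hd ν hν μ hμ)
    · intro ν hν μ hμ
      rw [Finset.mem_insert] at hν hμ
      push Not at hμ
      rcases hν with rfl | hν
      · exact hle μ hμ.2
      · exact hmin ν hν μ hμ.2

/-- N-term tail bound: choosing a downward closed set `Λ_N` of the `N` indices with the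
smallest values of `b_ν`, the weighted tail `Σ_{ν∉Λ_N} c_ν a_ν` decays like `(N+1)^{-s}`
with `s = 1/q - 1/2`. -/
theorem nterm_tail_bound (q : ℝ) (hq0 : 0 < q) (hq2 : q < 2)
    (τ : ℕ → ℝ) (hτ : ∀ j, 0 < τ j)
    (hτq : Summable fun j : ℕ => τ j ^ (-q))
    (r : ℕ) (hr : 0 < r) (hrq : 14 / q < (r : ℝ))
    (a : (ℕ →₀ ℕ) → ℝ) (ha : ∀ ν, 0 ≤ a ν)
    (hsum : Summable fun ν : ℕ →₀ ℕ => bwt r τ ν * (a ν) ^ 2) :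
    ∃ C : ℝ, ∀ N : ℕ, 1 ≤ N → ∃ Λ : Finset (ℕ →₀ ℕ),
      DownwardClosed (↑Λ : Set (ℕ →₀ ℕ)) ∧ Λ.card = N ∧
      (∀ ν ∈ Λ, ∀ μ : ℕ →₀ ℕ, μ ∉ Λ → bwt r τ ν ≤ bwt r τ μ) ∧
      Summable (fun ν : {ν : ℕ →₀ ℕ // ν ∉ Λ} => cwt ↑ν * a ↑ν) ∧
      ∑' ν : {ν : ℕ →₀ ℕ // ν ∉ Λ}, cwt ↑ν * a ↑ν ≤
        C * ((N : ℝ) + 1) ^ (-(1 / q - 1 / 2)) := by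
  have hb1 := one_le_bwt r τ hτ
  have hb0 : ∀ ν, 0 < bwt r τ ν := fun ν => zero_lt_one.trans_le (hb1 ν)
  have hW := summable_W q hq0 τ hτ hτq r hr hrq
  have hW0 : ∀ ν : ℕ →₀ ℕ, 0 ≤ cwt ν ^ 2 * bwt r τ ν ^ (-(q / 2)) := fun ν => by
    have := hb0 ν; positivity
  set S := ∑' ν : ℕ →₀ ℕ, cwt ν ^ 2 * bwt r τ ν ^ (-(q / 2)) with hS
  have hS0 : 0 ≤ S := tsum_nonneg hW0
  have hA0 : ∀ ν : ℕ →₀ ℕ, 0 ≤ bwt r τ ν * a ν ^ 2 := fun ν => by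
    have := hb0 ν; positivity
  set A := ∑' ν : ℕ →₀ ℕ, bwt r τ ν * a ν ^ 2 with hA
  have hbW : ∀ ν : ℕ →₀ ℕ, bwt r τ ν ^ (-(q / 2)) ≤ cwt ν ^ 2 * bwt r τ ν ^ (-(q / 2)) := fun ν =>
    le_mul_of_one_le_left (Real.rpow_nonneg (hb0 ν).le _) (one_le_pow₀ (one_le_cwt ν))
  have hfin : ∀ x, {ν | bwt r τ ν ≤ x}.Finite := by
    intro x
    by_cases hx : 0 < x
    · have h := hW.tendsto_cofinite_zero.eventually
        (gt_mem_nhds (Real.rpow_pos_of_pos hx (-(q / 2))))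
      rw [Filter.eventually_cofinite] at h
      refine h.subset fun ν hν => ?_
      simp only [Set.mem_setOf_eq, not_lt] at hν ⊢
      exact (Real.rpow_le_rpow_of_nonpos (hb0 ν) hν (by linarith)).trans (hbW ν)
    · convert Set.finite_empty
      ext ν
      simp only [Set.mem_setOf_eq, Set.mem_empty_iff_false, iff_false, not_le]
      linarith [hb0 ν]
  set s := 1 / q - 1 / 2 with hs
  have hs0 : 0 < s := by
    have := one_div_lt_one_div_of_lt hq0 hq2
    linarith
  refine ⟨(A + S * S ^ (2 * s)) / 2, fun N hN => ?_⟩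
  obtain ⟨Λ, hd, hc, hmin⟩ := exists_set (bwt r τ) (fun μ ν h => bwt_mono r τ hτ h) hfin N
  refine ⟨Λ, hd, hc, hmin, ?_⟩
  set n1 : ℝ := (N : ℝ) + 1 with hn1
  have hn1p : 0 < n1 := by positivity
  have htail : ∀ μ, μ ∉ Λ → bwt r τ μ ^ (-(q / 2)) ≤ S / n1 := by
    intro μ hμ
    rw [le_div_iff₀ hn1p]
    calc bwt r τ μ ^ (-(q / 2)) * n1 = ∑ ν ∈ insert μ Λ, bwt r τ μ ^ (-(q / 2)) := by
          rw [Finset.sum_const, Finset.card_insert_of_notMem hμ, hc, nsmul_eq_mul]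
          push_cast; ring
      _ ≤ ∑ ν ∈ insert μ Λ, cwt ν ^ 2 * bwt r τ ν ^ (-(q / 2)) := by
          refine Finset.sum_le_sum fun ν hν => le_trans ?_ (hbW ν)
          rcases Finset.mem_insert.1 hν with rfl | hν
          · exact le_rfl
          · exact Real.rpow_le_rpow_of_nonpos (hb0 ν) (hmin ν hν μ hμ) (by linarith)
      _ ≤ S := hW.sum_le_tsum _ fun ν _ => hW0 ν
  set θ := n1 ^ (-s) with hθ
  have hθ0 : 0 < θ := Real.rpow_pos_of_pos hn1p _
  have hpt : ∀ ν : {ν : ℕ →₀ ℕ // ν ∉ Λ}, cwt ↑ν * a ↑ν ≤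
      θ / 2 * (bwt r τ ν * a ν ^ 2) +
        θ * S ^ (2 * s) / 2 * (cwt ν ^ 2 * bwt r τ ν ^ (-(q / 2))) := by
    rintro ⟨ν, hν⟩
    dsimp only
    have hb := hb0 ν
    have h1 : (bwt r τ ν)⁻¹ ≤ bwt r τ ν ^ (-(q / 2)) * (S ^ (2 * s) * θ ^ 2) := by
      have e1 : (bwt r τ ν)⁻¹ = bwt r τ ν ^ (-(q / 2)) * (bwt r τ ν ^ (-(q / 2))) ^ (2 * s) := by
        rw [← Real.rpow_mul hb.le, ← Real.rpow_add hb, ← Real.rpow_neg_one]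
        congr 1
        rw [hs]; field_simp; ring
      have e2 : (S / n1) ^ (2 * s) = S ^ (2 * s) * θ ^ 2 := by
        rw [Real.div_rpow hS0 hn1p.le, hθ, ← Real.rpow_natCast _ 2, ← Real.rpow_mul hn1p.le,
          div_eq_mul_inv, ← Real.rpow_neg hn1p.le]
        congr 2
        push_cast; ring
      rw [e1, ← e2]
      have := htail ν hν
      gcongr
    have h2 : cwt ν * a ν ≤ θ / 2 * (bwt r τ ν * a ν ^ 2) + (cwt ν ^ 2 * (bwt r τ ν)⁻¹) / (2 * θ) := by
      have e : θ / 2 * (bwt r τ ν * a ν ^ 2) + (cwt ν ^ 2 * (bwt r τ ν)⁻¹) / (2 * θ) - cwt ν * a ν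
          = (θ * bwt r τ ν * a ν - cwt ν) ^ 2 / (2 * θ * bwt r τ ν) := by
        field_simp; ring
      have : 0 ≤ (θ * bwt r τ ν * a ν - cwt ν) ^ 2 / (2 * θ * bwt r τ ν) := by positivity
      linarith
    refine h2.trans ?_
    gcongr
    rw [div_le_iff₀ (by positivity)]
    calc cwt ν ^ 2 * (bwt r τ ν)⁻¹ ≤ cwt ν ^ 2 * (bwt r τ ν ^ (-(q / 2)) * (S ^ (2 * s) * θ ^ 2)) := by
          gcongr
      _ = _ := by ring
  have hsA : Summable fun ν : {ν : ℕ →₀ ℕ // ν ∉ Λ} => bwt r τ ν * a ν ^ 2 :=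
    hsum.comp_injective Subtype.val_injective
  have hsW : Summable fun ν : {ν : ℕ →₀ ℕ // ν ∉ Λ} => cwt (ν : ℕ →₀ ℕ) ^ 2 * bwt r τ ν ^ (-(q / 2)) :=
    hW.comp_injective Subtype.val_injective
  have htA : ∑' ν : {ν : ℕ →₀ ℕ // ν ∉ Λ}, bwt r τ ν * a ν ^ 2 ≤ A :=
    hsA.tsum_le_tsum_of_inj Subtype.val Subtype.val_injective (fun c _ => hA0 c)
      (fun _ => le_rfl) hsum
  have htW : ∑' ν : {ν : ℕ →₀ ℕ // ν ∉ Λ}, cwt (ν : ℕ →₀ ℕ) ^ 2 * bwt r τ ν ^ (-(q / 2)) ≤ S :=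
    hsW.tsum_le_tsum_of_inj Subtype.val Subtype.val_injective (fun c _ => hW0 c)
      (fun _ => le_rfl) hW
  have hsR := (hsA.mul_left (θ / 2)).add (hsW.mul_left (θ * S ^ (2 * s) / 2))
  have hsL : Summable (fun ν : {ν : ℕ →₀ ℕ // ν ∉ Λ} => cwt ↑ν * a ↑ν) :=
    Summable.of_nonneg_of_le
      (fun ν => mul_nonneg (zero_le_one.trans (one_le_cwt _)) (ha _)) hpt hsR
  refine ⟨hsL, ?_⟩
  calc ∑' ν : {ν : ℕ →₀ ℕ // ν ∉ Λ}, cwt ↑ν * a ↑ν ≤ _ := hsL.tsum_le_tsum hpt hsR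
    _ = θ / 2 * (∑' ν : {ν : ℕ →₀ ℕ // ν ∉ Λ}, bwt r τ ν * a ν ^ 2) + θ * S ^ (2 * s) / 2 *
        ∑' ν : {ν : ℕ →₀ ℕ // ν ∉ Λ}, cwt (ν : ℕ →₀ ℕ) ^ 2 * bwt r τ ν ^ (-(q / 2)) := by
        rw [(hsA.mul_left (θ / 2)).tsum_add (hsW.mul_left (θ * S ^ (2 * s) / 2)),
          tsum_mul_left, tsum_mul_left]
    _ ≤ θ / 2 * A + θ * S ^ (2 * s) / 2 * S := by gcongr
    _ = _ := by ring
end
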